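/- arXiv:1605.06631 — 2 statements merged into one kernel-verified Lean document; each statement's English description precedes it below -/
import Mathlib

section
/- For |q|<1, φ(q)·φ(q^{11}) = 1 + (2/3)·∑_{j≥1} χ₁₁(j)·( q^j/(1−q^j) + 2q^{4j}/(1−q^{4j}) ) + (4/3)·η₂η₂₂, where χ₁₁ is the Legendre symbol mod 11 and η₂η₂₂ = q·∏_{n≥1}(1−q^{2n})(1−q^{22n}). -/
noncomputable section

instance : Fact (Nat.Prime 11) := ⟨by norm_num⟩

open Function

/-- The sum of `g` over the values of the binary quadratic form `a x² + b x y + c y²`. -/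
def latticeSum (a b c : ℤ) (g : ℤ → ℂ) : ℂ :=
  ∑' v : ℤ × ℤ, g (a * v.1 ^ 2 + b * (v.1 * v.2) + c * v.2 ^ 2)

theorem tsum_ite_eq_tsum_comp {h : ℤ × ℤ → ℂ} {S : ℤ × ℤ → Prop} [DecidablePred S]
    (e : ℤ × ℤ → ℤ × ℤ) (he : Injective e) (hS : ∀ v, S v ↔ ∃ w, e w = v) :
    ∑' v, (if S v then h v else 0) = ∑' w, h (e w) := by
  rw [← he.tsum_eq (f := fun v ↦ if S v then h v else 0)]
  · exact tsum_congr fun w ↦ if_pos ((hS _).2 ⟨w, rfl⟩)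
  · intro v hv
    exact (hS v).1 (by by_contra hn; simp [hn] at hv)

theorem Summable.ite_zero {α : Type*} {h : α → ℂ} (hh : Summable h) (S : α → Prop)
    [DecidablePred S] : Summable fun v ↦ if S v then h v else 0 := by
  refine (hh.indicator {v | S v}).congr fun v ↦ ?_
  by_cases hv : S v <;> simp [hv]

section Equivalence

variable (a b c : ℤ) (g : ℤ → ℂ)

theorem latticeSum_swap : latticeSum a b c g = latticeSum c b a g := by
  unfold latticeSum
  rw [← (Equiv.prodComm ℤ ℤ).tsum_eq]
  refine tsum_congr fun v ↦ congrArg g ?_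
  simp only [Equiv.prodComm_apply, Prod.fst_swap, Prod.snd_swap]
  ring

theorem latticeSum_neg : latticeSum a b c g = latticeSum a (-b) c g := by
  unfold latticeSum
  rw [← ((Equiv.neg ℤ).prodCongr (Equiv.refl ℤ)).tsum_eq]
  refine tsum_congr fun v ↦ congrArg g ?_
  simp only [Equiv.prodCongr_apply, Prod.map_fst, Prod.map_snd, Equiv.neg_apply, Equiv.refl_apply]
  ring

theorem latticeSum_shear (t : ℤ) :
    latticeSum a b c g = latticeSum a (b + 2 * a * t) (a * t ^ 2 + b * t + c) g := by
  unfold latticeSum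
  let e : ℤ × ℤ ≃ ℤ × ℤ :=
    { toFun := fun v ↦ (v.1 + t * v.2, v.2)
      invFun := fun v ↦ (v.1 - t * v.2, v.2)
      left_inv := fun v ↦ by simp
      right_inv := fun v ↦ by simp }
  rw [← e.tsum_eq]
  refine tsum_congr fun v ↦ congrArg g ?_
  simp only [e, Equiv.coe_fn_mk]
  ring

end Equivalence

/-- There is a single class of positive definite forms of discriminant `-11`. -/
theorem latticeSum_eq_of_discrim (g : ℤ → ℂ) (n : ℕ) : ∀ a b c : ℤ, a.toNat ≤ n → 0 < a →
    b ^ 2 - 4 * a * c = -11 → latticeSum a b c g = latticeSum 1 1 3 g := by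
  induction n with
  | zero => intro a b c h1 h2; omega
  | succ n ih =>
    intro a b c hn ha hd
    obtain ⟨t, ht⟩ : ∃ t : ℤ, |b + 2 * a * t| ≤ a := by
      refine ⟨-((b + a) / (2 * a)), ?_⟩
      have h1 := Int.emod_nonneg (b + a) (by omega : 2 * a ≠ 0)
      have h2 := Int.emod_lt_of_pos (b + a) (by omega : 0 < 2 * a)
      have h3 := Int.emod_add_mul_ediv (b + a) (2 * a)
      rw [abs_le]
      constructor <;> linarith
    rw [latticeSum_shear a b c g t]
    have hd' : (b + 2 * a * t) ^ 2 - 4 * a * (a * t ^ 2 + b * t + c) = -11 := by linarith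
    generalize b + 2 * a * t = b' at *
    generalize a * t ^ 2 + b * t + c = c' at *
    have hb : b' ^ 2 ≤ a ^ 2 := sq_le_sq' (abs_le.1 ht).1 (abs_le.1 ht).2
    have hc : 0 < c' := by
      by_contra hc
      nlinarith [sq_nonneg b', mul_nonneg ha.le (sub_nonneg.2 (not_lt.1 hc))]
    rcases lt_or_ge c' a with hca | hca
    · rw [latticeSum_swap]
      exact ih _ _ _ (by omega) hc (by linarith)
    · have ha1 : a = 1 := by nlinarith
      subst ha1
      have h1 := abs_le.1 ht
      have h3 : b' = 1 ∨ b' = -1 := by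
        have : b' ≠ 0 := by rintro rfl; omega
        omega
      rcases h3 with rfl | rfl
      · rw [show c' = 3 by linarith]
      · rw [show c' = 3 by linarith, latticeSum_neg, neg_neg]

/-- The genus relation obtained from the three sublattices of index two. -/
theorem latticeSum_genus {g : ℤ → ℂ}
    (hg : Summable fun v : ℤ × ℤ ↦ g (1 * v.1 ^ 2 + 1 * (v.1 * v.2) + 3 * v.2 ^ 2)) :
    latticeSum 1 0 11 g + 2 * latticeSum 3 2 4 g =
      latticeSum 1 1 3 g + 2 * latticeSum 1 1 3 (fun k ↦ g (4 * k)) := by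
  set h : ℤ × ℤ → ℂ := fun v ↦ g (1 * v.1 ^ 2 + 1 * (v.1 * v.2) + 3 * v.2 ^ 2) with hh
  have e1 : ∑' v, (if v.2 % 2 = 0 then h v else 0) = latticeSum 1 0 11 g := by
    rw [tsum_ite_eq_tsum_comp (fun v ↦ (v.1 - v.2, 2 * v.2))]
    · exact tsum_congr fun v ↦ congrArg g (by ring)
    · rintro ⟨x, y⟩ ⟨z, w⟩ h; simp only [Prod.mk.injEq] at h ⊢; omega
    · rintro ⟨x, y⟩
      exact ⟨fun h ↦ ⟨(x + y / 2, y / 2), by ext <;> simp; omega⟩, by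
        rintro ⟨w, h⟩; simp only [Prod.mk.injEq] at h ⊢; omega⟩
  have e2 : ∑' v, (if v.1 % 2 = 0 then h v else 0) = latticeSum 3 2 4 g := by
    rw [tsum_ite_eq_tsum_comp (fun v ↦ (2 * v.2, v.1))]
    · exact tsum_congr fun v ↦ congrArg g (by ring)
    · rintro ⟨x, y⟩ ⟨z, w⟩ h; simp only [Prod.mk.injEq] at h ⊢; omega
    · rintro ⟨x, y⟩
      exact ⟨fun h ↦ ⟨(y, x / 2), by ext <;> simp; omega⟩, by
        rintro ⟨w, h⟩; simp only [Prod.mk.injEq] at h ⊢; omega⟩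
  have e3 : ∑' v, (if (v.1 + v.2) % 2 = 0 then h v else 0) = latticeSum 3 2 4 g := by
    rw [tsum_ite_eq_tsum_comp (fun v ↦ (-2 * v.2 - v.1, v.1))]
    · exact tsum_congr fun v ↦ congrArg g (by ring)
    · rintro ⟨x, y⟩ ⟨z, w⟩ h; simp only [Prod.mk.injEq] at h ⊢; omega
    · rintro ⟨x, y⟩
      exact ⟨fun h ↦ ⟨(y, -((x + y) / 2)), by ext <;> simp; grind⟩, by
        rintro ⟨w, h⟩; simp only [Prod.mk.injEq] at h ⊢; omega⟩
  have e4 : ∑' v, (if v.1 % 2 = 0 ∧ v.2 % 2 = 0 then h v else 0) =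
      latticeSum 1 1 3 (fun k ↦ g (4 * k)) := by
    rw [tsum_ite_eq_tsum_comp (fun v ↦ (2 * v.1, 2 * v.2))]
    · exact tsum_congr fun v ↦ congrArg g (by ring)
    · rintro ⟨x, y⟩ ⟨z, w⟩ h; simp only [Prod.mk.injEq] at h ⊢; omega
    · rintro ⟨x, y⟩
      exact ⟨fun h ↦ ⟨(x / 2, y / 2), by ext <;> simp <;> omega⟩, by
        rintro ⟨w, h⟩; simp only [Prod.mk.injEq] at h ⊢; omega⟩
  have e0 : ∑' v, h v = latticeSum 1 1 3 g := rfl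
  have s1 := hg.ite_zero fun v ↦ v.2 % 2 = 0
  have s2 := hg.ite_zero fun v ↦ v.1 % 2 = 0
  have s3 := hg.ite_zero fun v ↦ (v.1 + v.2) % 2 = 0
  have s4 := hg.ite_zero fun v ↦ v.1 % 2 = 0 ∧ v.2 % 2 = 0
  have key : ∑' v, ((if v.2 % 2 = 0 then h v else 0) +
      (if v.1 % 2 = 0 then h v else 0) + (if (v.1 + v.2) % 2 = 0 then h v else 0)) =
      ∑' v, (h v + 2 * (if v.1 % 2 = 0 ∧ v.2 % 2 = 0 then h v else 0)) :=
    tsum_congr fun v ↦ by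
      rcases Int.emod_two_eq_zero_or_one v.1 with h1 | h1 <;>
      rcases Int.emod_two_eq_zero_or_one v.2 with h2 | h2 <;>
      simp [h1, h2, Int.add_emod]
      ring
  rw [(s1.add s2).tsum_add s3, s1.tsum_add s2, hg.tsum_add (s4.mul_left 2), tsum_mul_left,
    e0, e1, e2, e3, e4] at key
  linear_combination key

/-- The number of representations of `n` by `x² + x y + 3 y²`. -/
def repCount (n : ℤ) : ℂ := latticeSum 1 1 3 fun k ↦ if k = n then 1 else 0

theorem summable_repCount (n : ℤ) : Summable fun v : ℤ × ℤ ↦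
    if 1 * v.1 ^ 2 + 1 * (v.1 * v.2) + 3 * v.2 ^ 2 = n then (1 : ℂ) else 0 := by
  refine summable_of_ne_finset_zero (s := Finset.Icc (-n) n ×ˢ Finset.Icc (-n) n) ?_
  rintro ⟨x, y⟩ hv
  refine if_neg fun h ↦ hv ?_
  simp only at h
  simp only [Finset.mem_product, Finset.mem_Icc]
  have hx : x ^ 2 ≤ 2 * n := by nlinarith [sq_nonneg (x + 2 * y), sq_nonneg y]
  have hx' : 11 * x ^ 2 ≤ 12 * n := by nlinarith [sq_nonneg (x + 6 * y)]
  have hy : 11 * y ^ 2 ≤ 4 * n := by nlinarith [sq_nonneg (2 * x + y)]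
  have hn : 0 ≤ n := by nlinarith [sq_nonneg x]
  refine ⟨abs_le.1 ?_, abs_le.1 ?_⟩
  · by_contra! hc
    have : (n + 1) ^ 2 ≤ x ^ 2 :=
      sq_le_sq' (by linarith [abs_nonneg x]) (by omega) |>.trans_eq (sq_abs x)
    nlinarith
  · by_contra! hc
    have : (n + 1) ^ 2 ≤ y ^ 2 :=
      sq_le_sq' (by linarith [abs_nonneg y]) (by omega) |>.trans_eq (sq_abs y)
    nlinarith

/-- The contribution of the index `p` sublattice `x ≡ t y` attached to a root `t` modulo `p`. -/
theorem tsum_root_sublattice {p t : ℤ} (hp : 0 < p) (ht : p ∣ t ^ 2 + t + 3) (n : ℤ) :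
    ∑' v : ℤ × ℤ, (if p ∣ v.1 - t * v.2 then
      (if 1 * v.1 ^ 2 + 1 * (v.1 * v.2) + 3 * v.2 ^ 2 = p * n then (1 : ℂ) else 0) else 0) =
      repCount n := by
  obtain ⟨c, hc⟩ := ht
  rw [repCount, ← latticeSum_eq_of_discrim _ p.toNat p (2 * t + 1) c le_rfl hp
    (by linear_combination 4 * hc)]
  rw [tsum_ite_eq_tsum_comp (fun v ↦ (p * v.1 + t * v.2, v.2))]
  · refine tsum_congr fun v ↦ if_congr ?_ rfl rfl
    rw [← mul_right_inj' hp.ne' (b := p * v.1 ^ 2 + _ + _)]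
    refine Eq.congr ?_ rfl
    linear_combination v.2 ^ 2 * hc
  · rintro ⟨x, y⟩ ⟨z, w⟩ h
    simp only [Prod.mk.injEq] at h ⊢
    obtain ⟨h1, rfl⟩ := h
    exact ⟨mul_left_cancel₀ hp.ne' (add_right_cancel h1), rfl⟩
  · rintro ⟨x, y⟩
    constructor
    · rintro ⟨k, hk⟩
      exact ⟨(k, y), by ext <;> simp at *; linarith⟩
    · rintro ⟨w, h⟩
      simp only [Prod.mk.injEq] at h ⊢
      exact ⟨w.1, by rw [← h.1, ← h.2]; ring⟩

/-- The contribution of the sublattice of multiples of `p`. -/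
theorem tsum_multiples {p : ℤ} (hp : 0 < p) (n : ℤ) :
    ∑' v : ℤ × ℤ, (if p ∣ v.1 ∧ p ∣ v.2 then
      (if 1 * v.1 ^ 2 + 1 * (v.1 * v.2) + 3 * v.2 ^ 2 = p * n then (1 : ℂ) else 0) else 0) =
      if p ∣ n then repCount (n / p) else 0 := by
  have h1 : ∑' v : ℤ × ℤ, (if p ∣ v.1 ∧ p ∣ v.2 then
      (if 1 * v.1 ^ 2 + 1 * (v.1 * v.2) + 3 * v.2 ^ 2 = p * n then (1 : ℂ) else 0) else 0) =
      ∑' v : ℤ × ℤ, if p * (1 * v.1 ^ 2 + 1 * (v.1 * v.2) + 3 * v.2 ^ 2) = n then (1 : ℂ)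
        else 0 := by
    rw [tsum_ite_eq_tsum_comp (fun v ↦ (p * v.1, p * v.2))]
    · refine tsum_congr fun v ↦ if_congr ?_ rfl rfl
      rw [← mul_right_inj' hp.ne' (c := n)]
      exact Eq.congr (by ring) rfl
    · rintro ⟨x, y⟩ ⟨z, w⟩ h
      simp only [Prod.mk.injEq] at h ⊢
      exact ⟨mul_left_cancel₀ hp.ne' h.1, mul_left_cancel₀ hp.ne' h.2⟩
    · rintro ⟨x, y⟩
      constructor
      · rintro ⟨⟨k, hk⟩, l, hl⟩
        exact ⟨(k, l), by simp at *; simp [hk, hl]⟩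
      · rintro ⟨w, h⟩
        simp only [Prod.mk.injEq] at h ⊢
        exact ⟨⟨_, h.1.symm⟩, ⟨_, h.2.symm⟩⟩
  rw [h1]
  split_ifs with h
  · obtain ⟨m, rfl⟩ := h
    rw [Int.mul_ediv_cancel_left _ hp.ne']
    exact tsum_congr fun v ↦ if_congr (mul_right_inj' hp.ne') rfl rfl
  · exact (tsum_congr fun v ↦ if_neg fun hv ↦ h (Dvd.intro _ hv)).trans tsum_zero

theorem legendreSym_neg_eleven {p : ℕ} [Fact p.Prime] (hp : p ≠ 2) :
    legendreSym p (-11) = legendreSym 11 p := by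
  rw [legendreSym.at_neg hp]
  have h11 := legendreSym.quadratic_reciprocity' (p := 11) (q := p) (by norm_num) hp
  have hodd := (Fact.out : p.Prime).eq_two_or_odd.resolve_left hp
  rw [ZMod.χ₄_eq_neg_one_pow hodd]
  push_cast at h11
  rw [h11, ← mul_assoc]
  rw [← pow_add, show p / 2 + 11 / 2 * (p / 2) = 2 * (3 * (p / 2)) by ring, pow_mul]
  simp

/-- A root of `t² + t + 3` modulo every prime at which `-11` is a residue. -/
theorem exists_root {p : ℕ} [Fact p.Prime] (hp : p ≠ 2) (h : legendreSym 11 p = 1) :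
    ∃ t : ℤ, (p : ℤ) ∣ t ^ 2 + t + 3 := by
  have hpp : p.Prime := Fact.out
  rw [← legendreSym_neg_eleven hp] at h
  have h0 : ((-11 : ℤ) : ZMod p) ≠ 0 := fun h0 ↦ by
    rw [(legendreSym.eq_zero_iff p _).2 h0] at h
    exact zero_ne_one h
  obtain ⟨s, hs⟩ := (legendreSym.eq_one_iff p h0).1 h
  obtain ⟨s, rfl⟩ := ZMod.intCast_surjective s
  have hs' : (p : ℤ) ∣ s * s + 11 := by
    rw [← ZMod.intCast_zmod_eq_zero_iff_dvd]
    push_cast at hs ⊢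
    rw [← hs]
    ring
  have hodd := hpp.eq_two_or_odd.resolve_left hp
  obtain ⟨u, hu⟩ : ∃ u : ℤ, (p : ℤ) ∣ (2 * u + 1) ^ 2 + 11 := by
    obtain ⟨k, hk⟩ := hs'
    rcases Int.emod_two_eq_zero_or_one s with h2 | h2
    · refine ⟨(s + p) / 2, ?_⟩
      have : 2 * ((s + p) / 2) + 1 = s + (p : ℤ) := by omega
      rw [this]
      exact ⟨k + 2 * s + p, by linear_combination hk⟩
    · refine ⟨s / 2, ?_⟩
      have : 2 * (s / 2) + 1 = s := by omega
      rw [this]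
      exact ⟨k, by linarith⟩
  refine ⟨u, ?_⟩
  have hcop : IsCoprime (p : ℤ) 4 := by
    exact_mod_cast Nat.isCoprime_iff_coprime.2
      (((Nat.coprime_primes hpp Nat.prime_two).2 hp).pow_right 2)
  refine hcop.dvd_of_dvd_mul_left (z := u ^ 2 + u + 3) ?_
  rwa [show 4 * (u ^ 2 + u + 3) = (2 * u + 1) ^ 2 + 11 by ring]

theorem repCount_mul_of_split {p : ℕ} [Fact p.Prime] (hp : p ≠ 2) (h : legendreSym 11 p = 1)
    (n : ℤ) : repCount (p * n) = 2 * repCount n - if (p : ℤ) ∣ n then repCount (n / p) else 0 := by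
  have hpp : p.Prime := Fact.out
  have hp' : Prime (p : ℤ) := Nat.prime_iff_prime_int.1 hpp
  have hp0 : (0 : ℤ) < p := by exact_mod_cast hpp.pos
  obtain ⟨t, ht⟩ := exists_root hp h
  have ht' : (p : ℤ) ∣ (-1 - t) ^ 2 + (-1 - t) + 3 := by convert ht using 1; ring
  have h11 : ¬ (p : ℤ) ∣ 11 := fun h11 ↦ by
    have : (((p : ℕ) : ℤ) : ZMod 11) = 0 := by
      rw [(Nat.prime_dvd_prime_iff_eq hpp (by norm_num)).1 (by exact_mod_cast h11 : p ∣ 11)]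
      rfl
    rw [(legendreSym.eq_zero_iff 11 _).2 this] at h
    exact zero_ne_one h
  have hs := summable_repCount (p * n)
  rw [← tsum_multiples hp0, two_mul]
  nth_rw 1 [← tsum_root_sublattice hp0 ht n]
  rw [← tsum_root_sublattice hp0 ht' n, ← (hs.ite_zero _).tsum_add (hs.ite_zero _),
    ← ((hs.ite_zero _).add (hs.ite_zero _)).tsum_sub (hs.ite_zero _)]
  refine tsum_congr fun v ↦ ?_
  obtain ⟨x, y⟩ := v
  obtain ⟨c, hc⟩ := ht
  simp only
  by_cases hv : 1 * x ^ 2 + 1 * (x * y) + 3 * y ^ 2 = p * n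
  · have hor : (p : ℤ) ∣ x - t * y ∨ (p : ℤ) ∣ x - (-1 - t) * y :=
      hp'.dvd_or_dvd ⟨n - c * y ^ 2, by linear_combination hv - y ^ 2 * hc⟩
    have hand : (p : ℤ) ∣ x ∧ (p : ℤ) ∣ y ↔ (p : ℤ) ∣ x - t * y ∧ (p : ℤ) ∣ x - (-1 - t) * y := by
      refine ⟨fun ⟨h1, h2⟩ ↦ ⟨dvd_sub h1 (h2.mul_left _), dvd_sub h1 (h2.mul_left _)⟩, ?_⟩
      rintro ⟨h1, h2⟩
      have h3 : (p : ℤ) ∣ (2 * t + 1) * y := by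
        rw [show (2 * t + 1) * y = x - (-1 - t) * y - (x - t * y) by ring]
        exact dvd_sub h2 h1
      have h4 : (p : ℤ) ∣ y := by
        refine (hp'.dvd_or_dvd h3).resolve_left fun ⟨d, hd⟩ ↦ h11 ?_
        exact ⟨4 * c - d * (2 * t + 1), by linear_combination 4 * hc - (2 * t + 1) * hd⟩
      exact ⟨(dvd_sub_left (h4.mul_left t)).1 h1, h4⟩
    simp only [hv, if_true, hand]
    split_ifs <;> first | tauto | norm_num
  · simp only [if_neg hv, ite_self, add_zero, sub_zero]

theorem repCount_mul_of_inert {p : ℕ} [Fact p.Prime] (h : legendreSym 11 p = -1) (n : ℤ) :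
    repCount (p * n) = if (p : ℤ) ∣ n then repCount (n / p) else 0 := by
  have hpp : p.Prime := Fact.out
  have hp0 : (0 : ℤ) < p := by exact_mod_cast hpp.pos
  rw [← tsum_multiples hp0]
  refine tsum_congr fun v ↦ ?_
  obtain ⟨x, y⟩ := v
  simp only
  by_cases hv : 1 * x ^ 2 + 1 * (x * y) + 3 * y ^ 2 = p * n
  · rw [if_pos hv, if_pos]
    rcases eq_or_ne p 2 with rfl | hp
    · push_cast at hv ⊢
      rcases Int.emod_two_eq_zero_or_one x with h1 | h1 <;>
      rcases Int.emod_two_eq_zero_or_one y with h2 | h2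
      · omega
      all_goals
        have := congrArg (· % 2) hv
        simp [pow_two, Int.add_emod, Int.mul_emod, h1, h2] at this
    · rw [← legendreSym_neg_eleven hp] at h
      have := legendreSym.prime_dvd_of_eq_neg_one h (x := 2 * x + y) (y := y)
        ⟨4 * n, by linear_combination 4 * hv⟩
      refine ⟨?_, this.2⟩
      have h2 : (p : ℤ) ∣ 2 * x := (dvd_add_left this.2).1 this.1
      refine (Nat.isCoprime_iff_coprime.2 ?_ : IsCoprime (p : ℤ) (2 : ℕ)).dvd_of_dvd_mul_left h2
      exact (Nat.coprime_primes hpp Nat.prime_two).2 hp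
  · simp only [if_neg hv, ite_self]

theorem repCount_mul_eleven (n : ℤ) : repCount (11 * n) = repCount n := by
  rw [← tsum_root_sublattice (p := 11) (t := 5) (by norm_num) (by norm_num) n]
  refine tsum_congr fun v ↦ ?_
  obtain ⟨x, y⟩ := v
  simp only
  by_cases hv : 1 * x ^ 2 + 1 * (x * y) + 3 * y ^ 2 = 11 * n
  · rw [if_pos hv, if_pos]
    have : Prime (11 : ℤ) := Nat.prime_iff_prime_int.1 (by norm_num)
    exact this.dvd_of_dvd_pow (n := 2) ⟨n - x * y + 2 * y ^ 2, by linear_combination hv⟩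
  · simp only [if_neg hv, ite_self]

theorem legendreSym_eleven_two : legendreSym 11 2 = -1 := by decide

theorem repCount_prime_mul {p : ℕ} (hp : p.Prime) (n : ℤ) :
    repCount (p * n) = (1 + (legendreSym 11 p : ℂ)) * repCount n -
      legendreSym 11 p * if (p : ℤ) ∣ n then repCount (n / p) else 0 := by
  have := Fact.mk hp
  by_cases h0 : (((p : ℕ) : ℤ) : ZMod 11) = 0
  · have h11 : p = 11 := by
      rw [Int.cast_natCast, ZMod.natCast_eq_zero_iff] at h0
      exact ((Nat.prime_dvd_prime_iff_eq (by norm_num) hp).1 h0).symm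
    rw [(legendreSym.eq_zero_iff 11 _).2 h0]
    subst h11
    simpa using repCount_mul_eleven n
  · rcases legendreSym.eq_one_or_neg_one 11 h0 with h | h
    · have h2 : p ≠ 2 := by
        rintro rfl
        rw [Nat.cast_ofNat, legendreSym_eleven_two] at h
        norm_num at h
      rw [repCount_mul_of_split h2 h, h]
      push_cast
      ring
    · rw [repCount_mul_of_inert h, h]
      push_cast
      ring

/-- The divisor sum of the Legendre symbol modulo `11`. -/
def charSum (n : ℕ) : ℂ := ∑ d ∈ n.divisors, (legendreSym 11 d : ℂ)

theorem charSum_prime_mul {p : ℕ} (hp : p.Prime) {n : ℕ} (hn : n ≠ 0) :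
    charSum (p * n) = (1 + (legendreSym 11 p : ℂ)) * charSum n -
      legendreSym 11 p * if p ∣ n then charSum (n / p) else 0 := by
  have himg (m : ℕ) : ∑ d ∈ m.divisors.image (p * ·), (legendreSym 11 d : ℂ) =
      legendreSym 11 p * charSum m := by
    rw [Finset.sum_image fun a _ b _ hab ↦ Nat.eq_of_mul_eq_mul_left hp.pos hab, charSum,
      Finset.mul_sum]
    refine Finset.sum_congr rfl fun d _ ↦ ?_
    rw [Nat.cast_mul, legendreSym.mul, Int.cast_mul]
  have hunion : (p * n).divisors = n.divisors ∪ n.divisors.image (p * ·) := by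
    ext d
    simp only [Finset.mem_union, Finset.mem_image, Nat.mem_divisors]
    constructor
    · rintro ⟨h, -⟩
      by_cases hd : p ∣ d
      · obtain ⟨e, rfl⟩ := hd
        exact Or.inr ⟨e, ⟨(Nat.mul_dvd_mul_iff_left hp.pos).1 h, hn⟩, rfl⟩
      · exact Or.inl ⟨((hp.coprime_iff_not_dvd.2 hd).symm).dvd_of_dvd_mul_left h, hn⟩
    · rintro (h | ⟨e, h, rfl⟩)
      · exact ⟨h.1.mul_left _, mul_ne_zero hp.ne_zero hn⟩
      · exact ⟨Nat.mul_dvd_mul_left _ h.1, mul_ne_zero hp.ne_zero hn⟩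
  have hinter : ∑ d ∈ n.divisors ∩ n.divisors.image (p * ·), (legendreSym 11 d : ℂ) =
      legendreSym 11 p * if p ∣ n then charSum (n / p) else 0 := by
    split_ifs with h
    · obtain ⟨m, rfl⟩ := h
      rw [Nat.mul_div_cancel_left _ hp.pos, ← himg]
      refine Finset.sum_congr ?_ fun _ _ ↦ rfl
      ext d
      simp only [Finset.mem_inter, Finset.mem_image, Nat.mem_divisors]
      constructor
      · rintro ⟨h, e, h', rfl⟩
        exact ⟨e, ⟨(Nat.mul_dvd_mul_iff_left hp.pos).1 h.1, right_ne_zero_of_mul hn⟩, rfl⟩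
      · rintro ⟨e, h, rfl⟩
        exact ⟨⟨Nat.mul_dvd_mul_left _ h.1, hn⟩, e, ⟨h.1.mul_left _, hn⟩, rfl⟩
    · rw [mul_zero]
      refine Finset.sum_eq_zero fun d hd ↦ absurd ?_ h
      simp only [Finset.mem_inter, Finset.mem_image, Nat.mem_divisors] at hd
      obtain ⟨h, e, h', rfl⟩ := hd
      exact (dvd_mul_right _ _).trans h.1
  have key := Finset.sum_union_inter (s₁ := n.divisors) (s₂ := n.divisors.image (p * ·))
    (f := fun d ↦ (legendreSym 11 d : ℂ))
  rw [← hunion, hinter, himg] at key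
  change charSum _ + _ = charSum _ + _ at key
  linear_combination key

theorem repCount_one : repCount 1 = 2 := by
  rw [repCount, latticeSum, tsum_eq_sum (s := {(1, 0), (-1, 0)})]
  · rw [Finset.sum_pair (by simp)]
    norm_num
  · rintro ⟨x, y⟩ hv
    refine if_neg fun h ↦ hv ?_
    simp only at h
    have hy : y = 0 := by
      have h1 : -1 < y := by nlinarith [sq_nonneg (2 * x + y)]
      have h2 : y < 1 := by nlinarith [sq_nonneg (2 * x + y)]
      omega
    subst hy
    have hx : x ^ 2 = 1 := by linarith
    rcases (sq_eq_sq_iff_eq_or_eq_neg (b := (1 : ℤ))).1 (by simpa using hx) with rfl | rfl <;> simp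

/-- Dirichlet's formula for the number of representations by `x² + x y + 3 y²`. -/
theorem repCount_eq (n : ℕ) (hn : n ≠ 0) : repCount n = 2 * charSum n := by
  induction n using Nat.strong_induction_on with
  | _ n ih =>
    rcases eq_or_ne n 1 with rfl | h1
    · simp [repCount_one, charSum]
    · obtain ⟨m, hm⟩ := Nat.minFac_dvd n
      have hp := Nat.minFac_prime h1
      generalize n.minFac = p at hm hp
      subst hm
      have hm0 := right_ne_zero_of_mul hn
      have hlt : m < p * m := lt_mul_of_one_lt_left (Nat.pos_of_ne_zero hm0) hp.one_lt
      rw [charSum_prime_mul hp hm0, Nat.cast_mul, repCount_prime_mul hp, ih m hlt hm0]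
      simp only [Int.natCast_dvd_natCast]
      split_ifs with h
      · obtain ⟨k, rfl⟩ := h
        have hk0 := right_ne_zero_of_mul hm0
        have hk : k ≤ p * k := Nat.le_mul_of_pos_left _ hp.pos
        rw [Nat.mul_div_cancel_left _ hp.pos, Nat.cast_mul,
          Int.mul_ediv_cancel_left _ (by exact_mod_cast hp.ne_zero), ih k (hk.trans_lt hlt) hk0]
        ring
      · ring

/-- The forms `x² + 11 y²` and `3 x² + 2 x y + 4 y²` differ by twice the pentagonal double sum. -/
theorem two_mul_tsum_pentagonal {g : ℤ → ℂ}
    (h₁ : Summable fun v : ℤ × ℤ ↦ g (1 * v.1 ^ 2 + 0 * (v.1 * v.2) + 11 * v.2 ^ 2))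
    (h₂ : Summable fun v : ℤ × ℤ ↦ g (3 * v.1 ^ 2 + 2 * (v.1 * v.2) + 4 * v.2 ^ 2))
    (h₃ : Summable fun v : ℤ × ℤ ↦ g (1 + v.1 * (3 * v.1 - 1) + 11 * (v.2 * (3 * v.2 - 1)))) :
    2 * ∑' v : ℤ × ℤ, (if (v.1 + v.2) % 2 = 0 then 1 else -1) *
      g (1 + v.1 * (3 * v.1 - 1) + 11 * (v.2 * (3 * v.2 - 1))) =
      latticeSum 1 0 11 g - latticeSum 3 2 4 g := by
  set f₁ : ℤ × ℤ → ℂ := fun v ↦ g (1 * v.1 ^ 2 + 0 * (v.1 * v.2) + 11 * v.2 ^ 2)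
  set f₂ : ℤ × ℤ → ℂ := fun v ↦ g (3 * v.1 ^ 2 + 2 * (v.1 * v.2) + 4 * v.2 ^ 2)
  set f₃ : ℤ × ℤ → ℂ := fun v ↦ g (1 + v.1 * (3 * v.1 - 1) + 11 * (v.2 * (3 * v.2 - 1)))
  have hsign : ∑' v : ℤ × ℤ, (if (v.1 + v.2) % 2 = 0 then 1 else -1) * f₃ v =
      ∑' v, (if (v.1 + v.2) % 2 = 0 then f₃ v else 0) -
        ∑' v, (if (v.1 + v.2) % 2 = 1 then f₃ v else 0) := by
    rw [← (h₃.ite_zero _).tsum_sub (h₃.ite_zero _)]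
    refine tsum_congr fun v ↦ ?_
    rcases Int.emod_two_eq_zero_or_one (v.1 + v.2) with h | h <;> simp [h]
  have even₃ : ∑' v, (if (v.1 + v.2) % 2 = 0 then f₃ v else 0) =
      ∑' v : ℤ × ℤ, g ((6 * v.2 - 1 + v.1) ^ 2 + 11 * v.1 ^ 2) := by
    rw [tsum_ite_eq_tsum_comp (fun v ↦ (v.2 + 2 * v.1, v.2))]
    · exact tsum_congr fun v ↦ congrArg g (by ring)
    · rintro ⟨x, y⟩ ⟨z, w⟩ h; simp only [Prod.mk.injEq] at h ⊢; omega
    · rintro ⟨x, y⟩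
      exact ⟨fun h ↦ ⟨((x - y) / 2, y), by ext <;> simp; grind⟩, by
        rintro ⟨w, h⟩; simp only [Prod.mk.injEq] at h ⊢; omega⟩
  have odd₃ : ∑' v, (if (v.1 + v.2) % 2 = 1 then f₃ v else 0) =
      ∑' v : ℤ × ℤ, g (3 * (2 * v.1 + 1) ^ 2 - 2 * ((2 * v.1 + 1) * (3 * v.2 + v.1)) +
        4 * (3 * v.2 + v.1) ^ 2) := by
    rw [tsum_ite_eq_tsum_comp (fun v ↦ (v.2 + 2 * v.1 + 1, v.2))]
    · exact tsum_congr fun v ↦ congrArg g (by ring)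
    · rintro ⟨x, y⟩ ⟨z, w⟩ h; simp only [Prod.mk.injEq] at h ⊢; omega
    · rintro ⟨x, y⟩
      exact ⟨fun h ↦ ⟨((x - y - 1) / 2, y), by ext <;> simp; grind⟩, by
        rintro ⟨w, h⟩; simp only [Prod.mk.injEq] at h ⊢; omega⟩
  have minus₁ : ∑' v, (if (v.1 + v.2) % 6 = 5 then f₁ v else 0) =
      ∑' v : ℤ × ℤ, g ((6 * v.2 - 1 + v.1) ^ 2 + 11 * v.1 ^ 2) := by
    rw [tsum_ite_eq_tsum_comp (fun v ↦ (6 * v.2 - 1 + v.1, -v.1))]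
    · exact tsum_congr fun v ↦ congrArg g (by ring)
    · rintro ⟨x, y⟩ ⟨z, w⟩ h; simp only [Prod.mk.injEq] at h ⊢; omega
    · rintro ⟨x, y⟩
      exact ⟨fun h ↦ ⟨(-y, (x + y + 1) / 6), by ext <;> simp; grind⟩, by
        rintro ⟨w, h⟩; simp only [Prod.mk.injEq] at h ⊢; omega⟩
  have plus₁ : ∑' v, (if (v.1 + v.2) % 6 = 1 then f₁ v else 0) =
      ∑' v : ℤ × ℤ, g ((6 * v.2 - 1 + v.1) ^ 2 + 11 * v.1 ^ 2) := by
    rw [tsum_ite_eq_tsum_comp (fun v ↦ (-(6 * v.2 - 1 + v.1), v.1))]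
    · exact tsum_congr fun v ↦ congrArg g (by ring)
    · rintro ⟨x, y⟩ ⟨z, w⟩ h; simp only [Prod.mk.injEq] at h ⊢; omega
    · rintro ⟨x, y⟩
      exact ⟨fun h ↦ ⟨(y, -((x + y) / 6)), by ext <;> simp; grind⟩, by
        rintro ⟨w, h⟩; simp only [Prod.mk.injEq] at h ⊢; omega⟩
  have minus₂ : ∑' v, (if v.1 % 2 = 1 ∧ (v.1 - v.2) % 3 = 2 then f₂ v else 0) =
      ∑' v : ℤ × ℤ, g (3 * (2 * v.1 + 1) ^ 2 - 2 * ((2 * v.1 + 1) * (3 * v.2 + v.1)) +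
        4 * (3 * v.2 + v.1) ^ 2) := by
    rw [tsum_ite_eq_tsum_comp (fun v ↦ (-2 * v.1 - 1, 3 * v.2 + v.1))]
    · exact tsum_congr fun v ↦ congrArg g (by ring)
    · rintro ⟨x, y⟩ ⟨z, w⟩ h; simp only [Prod.mk.injEq] at h ⊢; omega
    · rintro ⟨x, y⟩
      exact ⟨fun h ↦ ⟨((-1 - x) / 2, (y - (-1 - x) / 2) / 3), by ext <;> simp <;> omega⟩, by
        rintro ⟨w, h⟩; simp only [Prod.mk.injEq] at h ⊢; omega⟩
  have plus₂ : ∑' v, (if v.1 % 2 = 1 ∧ (v.1 - v.2) % 3 = 1 then f₂ v else 0) =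
      ∑' v : ℤ × ℤ, g (3 * (2 * v.1 + 1) ^ 2 - 2 * ((2 * v.1 + 1) * (3 * v.2 + v.1)) +
        4 * (3 * v.2 + v.1) ^ 2) := by
    rw [tsum_ite_eq_tsum_comp (fun v ↦ (2 * v.1 + 1, -(3 * v.2 + v.1)))]
    · exact tsum_congr fun v ↦ congrArg g (by ring)
    · rintro ⟨x, y⟩ ⟨z, w⟩ h; simp only [Prod.mk.injEq] at h ⊢; omega
    · rintro ⟨x, y⟩
      exact ⟨fun h ↦ ⟨((x - 1) / 2, (-y - (x - 1) / 2) / 3), by ext <;> simp <;> omega⟩, by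
        rintro ⟨w, h⟩; simp only [Prod.mk.injEq] at h ⊢; omega⟩
  have two₁ : ∑' v, (if (v.1 + v.2) % 2 = 0 then f₁ v else 0) =
      latticeSum 1 1 3 (fun k ↦ g (4 * k)) := by
    rw [tsum_ite_eq_tsum_comp (fun v ↦ (v.2 + 2 * v.1, v.2))]
    · exact tsum_congr fun v ↦ congrArg g (by ring)
    · rintro ⟨x, y⟩ ⟨z, w⟩ h; simp only [Prod.mk.injEq] at h ⊢; omega
    · rintro ⟨x, y⟩
      exact ⟨fun h ↦ ⟨((x - y) / 2, y), by ext <;> simp; grind⟩, by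
        rintro ⟨w, h⟩; simp only [Prod.mk.injEq] at h ⊢; omega⟩
  have two₂ : ∑' v, (if v.1 % 2 = 0 then f₂ v else 0) =
      latticeSum 1 1 3 (fun k ↦ g (4 * k)) := by
    rw [tsum_ite_eq_tsum_comp (fun v ↦ (2 * v.2, v.1))]
    · exact tsum_congr fun v ↦ congrArg g (by ring)
    · rintro ⟨x, y⟩ ⟨z, w⟩ h; simp only [Prod.mk.injEq] at h ⊢; omega
    · rintro ⟨x, y⟩
      exact ⟨fun h ↦ ⟨(y, x / 2), by ext <;> simp; omega⟩, by
        rintro ⟨w, h⟩; simp only [Prod.mk.injEq] at h ⊢; omega⟩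
  have three₁ : ∑' v, (if (v.1 + v.2) % 3 = 0 then f₁ v else 0) =
      latticeSum 3 2 4 (fun k ↦ g (3 * k)) := by
    rw [tsum_ite_eq_tsum_comp (fun v ↦ (v.2 + 3 * v.1, -v.2))]
    · exact tsum_congr fun v ↦ congrArg g (by ring)
    · rintro ⟨x, y⟩ ⟨z, w⟩ h; simp only [Prod.mk.injEq] at h ⊢; omega
    · rintro ⟨x, y⟩
      exact ⟨fun h ↦ ⟨((x + y) / 3, -y), by ext <;> simp; grind⟩, by
        rintro ⟨w, h⟩; simp only [Prod.mk.injEq] at h ⊢; omega⟩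
  have three₂ : ∑' v, (if (v.1 - v.2) % 3 = 0 then f₂ v else 0) =
      latticeSum 3 2 4 (fun k ↦ g (3 * k)) := by
    rw [tsum_ite_eq_tsum_comp (fun v ↦ (v.1 + 2 * v.2, v.1 - v.2))]
    · exact tsum_congr fun v ↦ congrArg g (by ring)
    · rintro ⟨x, y⟩ ⟨z, w⟩ h; simp only [Prod.mk.injEq] at h ⊢; omega
    · rintro ⟨x, y⟩
      exact ⟨fun h ↦ ⟨(y + (x - y) / 3, (x - y) / 3), by ext <;> simp; omega⟩, by
        rintro ⟨w, h⟩; simp only [Prod.mk.injEq] at h ⊢; omega⟩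
  have six₁ : ∑' v, (if (v.1 + v.2) % 6 = 0 then f₁ v else 0) =
      latticeSum 1 1 3 (fun k ↦ g (12 * k)) := by
    rw [tsum_ite_eq_tsum_comp (fun v ↦ (-6 * v.2 - v.1, v.1))]
    · exact tsum_congr fun v ↦ congrArg g (by ring)
    · rintro ⟨x, y⟩ ⟨z, w⟩ h; simp only [Prod.mk.injEq] at h ⊢; omega
    · rintro ⟨x, y⟩
      exact ⟨fun h ↦ ⟨(y, -((x + y) / 6)), by ext <;> simp; grind⟩, by
        rintro ⟨w, h⟩; simp only [Prod.mk.injEq] at h ⊢; omega⟩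
  have six₂ : ∑' v, (if v.1 % 2 = 0 ∧ (v.1 - v.2) % 3 = 0 then f₂ v else 0) =
      latticeSum 1 1 3 (fun k ↦ g (12 * k)) := by
    rw [tsum_ite_eq_tsum_comp (fun v ↦ (2 * v.2 + 2 * v.1, 2 * v.2 - v.1))]
    · exact tsum_congr fun v ↦ congrArg g (by ring)
    · rintro ⟨x, y⟩ ⟨z, w⟩ h; simp only [Prod.mk.injEq] at h ⊢; omega
    · rintro ⟨x, y⟩
      exact ⟨fun h ↦ ⟨((x - y) / 3, x / 2 - (x - y) / 3), by ext <;> simp <;> omega⟩, by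
        rintro ⟨w, h⟩; simp only [Prod.mk.injEq] at h ⊢; omega⟩
  have key₁ : ∑' v, (f₁ v + if (v.1 + v.2) % 6 = 0 then f₁ v else 0) =
      ∑' v, ((((if (v.1 + v.2) % 6 = 5 then f₁ v else 0) +
        if (v.1 + v.2) % 6 = 1 then f₁ v else 0) +
        if (v.1 + v.2) % 2 = 0 then f₁ v else 0) + if (v.1 + v.2) % 3 = 0 then f₁ v else 0) := by
    refine tsum_congr fun v ↦ ?_
    generalize f₁ v = z
    generalize v.1 + v.2 = k
    have h : k % 6 = 0 ∨ k % 6 = 1 ∨ k % 6 = 2 ∨ k % 6 = 3 ∨ k % 6 = 4 ∨ k % 6 = 5 := by omega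
    have h2 : k % 2 = k % 6 % 2 := by omega
    have h3 : k % 3 = k % 6 % 3 := by omega
    rcases h with h | h | h | h | h | h <;> simp [h2, h3, h]
  have key₂ : ∑' v, (f₂ v + if v.1 % 2 = 0 ∧ (v.1 - v.2) % 3 = 0 then f₂ v else 0) =
      ∑' v, ((((if v.1 % 2 = 1 ∧ (v.1 - v.2) % 3 = 2 then f₂ v else 0) +
        if v.1 % 2 = 1 ∧ (v.1 - v.2) % 3 = 1 then f₂ v else 0) +
        if v.1 % 2 = 0 then f₂ v else 0) + if (v.1 - v.2) % 3 = 0 then f₂ v else 0) := by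
    refine tsum_congr fun v ↦ ?_
    have h3 : (v.1 - v.2) % 3 = 0 ∨ (v.1 - v.2) % 3 = 1 ∨ (v.1 - v.2) % 3 = 2 := by omega
    rcases Int.emod_two_eq_zero_or_one v.1 with h2 | h2 <;> rcases h3 with h3 | h3 | h3 <;>
      simp [h2, h3]
  rw [h₁.tsum_add (h₁.ite_zero _), ((((h₁.ite_zero _).add (h₁.ite_zero _))).add
    (h₁.ite_zero _)).tsum_add (h₁.ite_zero _), ((h₁.ite_zero _).add (h₁.ite_zero _)).tsum_add
    (h₁.ite_zero _), (h₁.ite_zero _).tsum_add (h₁.ite_zero _), minus₁, plus₁, two₁, three₁, six₁]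
    at key₁
  rw [h₂.tsum_add (h₂.ite_zero _), ((((h₂.ite_zero _).add (h₂.ite_zero _))).add
    (h₂.ite_zero _)).tsum_add (h₂.ite_zero _), ((h₂.ite_zero _).add (h₂.ite_zero _)).tsum_add
    (h₂.ite_zero _), (h₂.ite_zero _).tsum_add (h₂.ite_zero _), minus₂, plus₂, two₂, three₂, six₂]
    at key₂
  rw [hsign, even₃, odd₃]
  change _ = ∑' v, f₁ v - ∑' v, f₂ v
  linear_combination key₂ - key₁

theorem summable_pow_natAbs {s : ℝ} (h₀ : 0 ≤ s) (h₁ : s < 1) :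
    Summable fun n : ℤ ↦ s ^ n.natAbs :=
  .of_nat_of_neg (by simpa using summable_geometric_of_lt_one h₀ h₁)
    (by simpa using summable_geometric_of_lt_one h₀ h₁)

theorem zpow_add_of_nonneg_exponents (q : ℂ) {a b : ℤ} (ha : 0 ≤ a) (hb : 0 ≤ b) :
    q ^ (a + b) = q ^ a * q ^ b :=
  zpow_add' (by right; omega)

theorem summable_norm_zpow_of_sq_add_sq_le {q : ℂ} (hq : ‖q‖ < 1) {F : ℤ × ℤ → ℤ}
    (hF : ∀ v, v.1 ^ 2 + v.2 ^ 2 ≤ 4 * F v) : Summable fun v ↦ ‖q ^ F v‖ := by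
  obtain ⟨s, hs₀, hs⟩ : ∃ s : ℝ, 0 ≤ s ∧ s ^ 4 = ‖q‖ :=
    ⟨‖q‖ ^ ((4 : ℕ) : ℝ)⁻¹, by positivity, Real.rpow_inv_natCast_pow (norm_nonneg q) (by simp)⟩
  have hs₁ : s < 1 := by
    by_contra! h
    linarith [one_le_pow₀ h (n := 4)]
  refine .of_nonneg_of_le (fun _ ↦ norm_nonneg _) (fun v ↦ ?_)
    ((summable_pow_natAbs hs₀ hs₁).mul_of_nonneg (summable_pow_natAbs hs₀ hs₁)
      (fun _ ↦ by positivity) (fun _ ↦ by positivity))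
  have hv := hF v
  obtain ⟨n, hn⟩ : ∃ n : ℕ, F v = n :=
    Int.eq_ofNat_of_zero_le (by nlinarith [sq_nonneg v.1, sq_nonneg v.2])
  have hle (m : ℤ) : (m.natAbs : ℤ) ≤ m ^ 2 := by
    rw [← Int.natAbs_sq]
    exact_mod_cast Nat.le_self_pow two_ne_zero _
  rw [hn, zpow_natCast, norm_pow, ← hs, ← pow_mul, ← pow_add]
  refine pow_le_pow_of_le_one hs₀ hs₁.le ?_
  have h₁ := hle v.1
  have h₂ := hle v.2
  omega

theorem summable_norm_zpow_sq {q : ℂ} (hq : ‖q‖ < 1) : Summable fun n : ℤ ↦ ‖q ^ (n ^ 2)‖ := by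
  refine .of_nonneg_of_le (fun _ ↦ norm_nonneg _) (fun n ↦ ?_)
    (summable_pow_natAbs (norm_nonneg q) hq)
  rw [← Int.natAbs_sq, ← Nat.cast_pow, zpow_natCast, norm_pow]
  exact pow_le_pow_of_le_one (norm_nonneg q) hq.le (Nat.le_self_pow two_ne_zero _)

theorem tsum_zpow_sq_mul_tsum_zpow_sq {q : ℂ} (hq : ‖q‖ < 1) :
    (∑' n : ℤ, q ^ (n ^ 2)) * (∑' n : ℤ, (q ^ 11) ^ (n ^ 2)) =
      latticeSum 1 0 11 fun k ↦ q ^ k := by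
  have hq' : ‖q ^ 11‖ < 1 := by
    rw [norm_pow]
    exact pow_lt_one₀ (norm_nonneg q) hq (by simp)
  rw [tsum_mul_tsum_of_summable_norm (summable_norm_zpow_sq hq) (summable_norm_zpow_sq hq'),
    latticeSum]
  refine tsum_congr fun v ↦ ?_
  rw [← zpow_natCast q 11, ← zpow_mul, ← zpow_add_of_nonneg_exponents q (by positivity)
    (by positivity)]
  congr 1
  push_cast
  ring

theorem hasSum_repCount {q : ℂ} (hq : ‖q‖ < 1) :
    HasSum (fun n : ℕ ↦ repCount n * q ^ n) (latticeSum 1 1 3 fun k ↦ q ^ k) := by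
  let F : ℤ × ℤ → ℤ := fun v ↦ 1 * v.1 ^ 2 + 1 * (v.1 * v.2) + 3 * v.2 ^ 2
  have hF (v : ℤ × ℤ) : 0 ≤ F v := by
    simp only [F]
    nlinarith [sq_nonneg (2 * v.1 + v.2), sq_nonneg v.2]
  have hsum : HasSum (fun v ↦ q ^ F v) (latticeSum 1 1 3 fun k ↦ q ^ k) :=
    (summable_norm_zpow_of_sq_add_sq_le hq (F := F) fun v ↦ by
      simp only [F]
      nlinarith [sq_nonneg (v.1 + v.2), sq_nonneg v.2, sq_nonneg v.1]).of_norm.hasSum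
  have hinj : Injective fun v : ℤ × ℤ ↦ ((F v).toNat, v) := fun v w h ↦ (Prod.ext_iff.mp h).2
  have hext : HasSum (fun p : ℕ × (ℤ × ℤ) ↦ if F p.2 = p.1 then q ^ p.1 else 0)
      (latticeSum 1 1 3 fun k ↦ q ^ k) := by
    refine (hinj.hasSum_iff fun p hp ↦ if_neg fun h ↦ hp ⟨p.2, ?_⟩).mp ?_
    · simp [h]
    · convert hsum using 2 with v
      obtain ⟨n, hn⟩ := Int.eq_ofNat_of_zero_le (hF v)
      simp [hn]
  refine hext.prod_fiberwise fun n ↦ ?_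
  have h := (summable_repCount n).hasSum.mul_right (q ^ n)
  simp only [ite_mul, one_mul (q ^ n), zero_mul] at h
  exact h

theorem repCount_zero : repCount 0 = 1 := by
  rw [repCount, latticeSum, tsum_eq_single (0, 0)]
  · simp
  · intro v hv
    refine if_neg fun h ↦ hv ?_
    have h₂ : v.2 = 0 := by
      by_contra h₀
      nlinarith [sq_nonneg (2 * v.1 + v.2), sq_pos_of_ne_zero h₀]
    have h₁ : v.1 = 0 := by simpa [h₂] using h
    exact Prod.ext h₁ h₂

theorem hasSum_charSum {q : ℂ} (hq : ‖q‖ < 1) :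
    HasSum (fun n : ℕ ↦ charSum (n + 1) * q ^ (n + 1))
      (((latticeSum 1 1 3 fun k ↦ q ^ k) - 1) / 2) := by
  have h := ((hasSum_nat_add_iff' 1).mpr (hasSum_repCount hq)).div_const 2
  simp only [Finset.range_one, Finset.sum_singleton, Nat.cast_zero, repCount_zero, pow_zero,
    mul_one] at h
  refine h.congr_fun fun n ↦ ?_
  rw [repCount_eq _ n.succ_ne_zero]
  ring

theorem hasSum_lambert {q : ℂ} (hq : ‖q‖ < 1) {c : ℕ → ℂ} (hc : ∀ n, ‖c n‖ ≤ 1) :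
    HasSum (fun j : ℕ ↦ c (j + 1) * (q ^ (j + 1) / (1 - q ^ (j + 1))))
      (∑' n : ℕ, (∑ d ∈ (n + 1).divisors, c d) * q ^ (n + 1)) := by
  let f : ℕ+ × ℕ+ → ℂ := fun p ↦ c p.1 * q ^ (p.1 * p.2 : ℕ)
  have hf : Summable f := by
    refine .of_norm_bounded (summable_prod_mul_pow 0 hq).norm fun p ↦ ?_
    rw [norm_mul, pow_zero, one_mul]
    exact mul_le_of_le_one_left (norm_nonneg _) (hc _)
  have h₁ : HasSum (fun a : ℕ+ ↦ c a * (q ^ (a : ℕ) / (1 - q ^ (a : ℕ)))) (∑' p, f p) := by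
    refine hf.hasSum.prod_fiberwise fun a ↦ ?_
    have ha : ‖q ^ (a : ℕ)‖ < 1 := by
      rw [norm_pow]
      exact pow_lt_one₀ (norm_nonneg q) hq a.ne_zero
    have h := ((hasSum_geometric_of_norm_lt_one ha).mul_left (q ^ (a : ℕ))).mul_left (c a)
    rw [← div_eq_mul_inv] at h
    refine (Equiv.pnatEquivNat.symm.hasSum_iff).mp (h.congr_fun fun n ↦ ?_)
    simp [f, pow_mul, pow_succ']
  have h₂ : HasSum (fun n : ℕ+ ↦ (∑ d ∈ (n : ℕ).divisors, c d) * q ^ (n : ℕ)) (∑' p, f p) := by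
    refine (sigmaAntidiagonalEquivProd.hasSum_iff.mpr hf.hasSum).sigma fun n ↦ ?_
    convert hasSum_fintype _ using 1
    rw [Finset.univ_eq_attach, Finset.sum_mul,
      ← Nat.sum_divisorsAntidiagonal fun d _ ↦ c d * q ^ (n : ℕ), ← Finset.sum_attach]
    refine Finset.sum_congr rfl fun x _ ↦ ?_
    have hx := (Nat.mem_divisorsAntidiagonal.mp x.2).1
    simp [f, sigmaAntidiagonalEquivProd, divisorsAntidiagonalFactors, hx]
  have h₃ := Equiv.pnatEquivNat.symm.hasSum_iff.mpr h₁
  have h₄ := Equiv.pnatEquivNat.symm.hasSum_iff.mpr h₂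
  have h₅ : ∑' n : ℕ, (∑ d ∈ (n + 1).divisors, c d) * q ^ (n + 1) = ∑' p, f p := by
    simpa [comp_def] using h₄.tsum_eq
  simpa [comp_def, h₅] using h₃

theorem norm_legendreSym_le_one (p : ℕ) [Fact p.Prime] (a : ℤ) :
    ‖(legendreSym p a : ℂ)‖ ≤ 1 := by
  by_cases h : (a : ZMod p) = 0
  · simp [(legendreSym.eq_zero_iff p a).mpr h]
  · rcases legendreSym.eq_one_or_neg_one p h with h | h <;> simp [h]

theorem hasSum_legendreSym_lambert {q : ℂ} (hq : ‖q‖ < 1) :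
    HasSum (fun j : ℕ ↦ (legendreSym 11 ((j : ℤ) + 1) : ℂ) *
        (q ^ (j + 1) / (1 - q ^ (j + 1))))
      (((latticeSum 1 1 3 fun k ↦ q ^ k) - 1) / 2) := by
  have h := hasSum_lambert hq (c := fun n ↦ (legendreSym 11 n : ℂ))
    fun n ↦ norm_legendreSym_le_one 11 n
  rw [← (hasSum_charSum hq).tsum_eq]
  simpa only [charSum, Nat.cast_add, Nat.cast_one, Int.cast_sum] using h

theorem norm_prod_one_sub_pow_le {x : ℂ} (hx : ‖x‖ < 1) (k n : ℕ) :
    ‖∏ i ∈ Finset.range n, (1 - x ^ (k + i + 1))‖ ≤ Real.exp (1 - ‖x‖)⁻¹ := by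
  calc ‖∏ i ∈ Finset.range n, (1 - x ^ (k + i + 1))‖
      ≤ ∏ i ∈ Finset.range n, Real.exp (‖x‖ ^ i) := by
        rw [norm_prod]
        refine Finset.prod_le_prod (fun _ _ ↦ norm_nonneg _) fun i _ ↦ ?_
        calc ‖1 - x ^ (k + i + 1)‖ ≤ 1 + ‖x‖ ^ (k + i + 1) := by
              simpa using norm_sub_le (1 : ℂ) (x ^ (k + i + 1))
          _ ≤ ‖x‖ ^ i + 1 := by
              rw [add_comm]
              gcongr ?_ + 1
              exact pow_le_pow_of_le_one (norm_nonneg x) hx.le (by omega)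
          _ ≤ Real.exp (‖x‖ ^ i) := Real.add_one_le_exp _
    _ ≤ Real.exp (1 - ‖x‖)⁻¹ := by
        rw [← Real.exp_sum, Real.exp_le_exp, ← tsum_geometric_of_lt_one (norm_nonneg x) hx]
        exact (summable_geometric_of_lt_one (norm_nonneg x) hx).sum_le_tsum _
          fun _ _ ↦ by positivity

theorem summable_norm_pow_pentagonal {x : ℂ} (hx : ‖x‖ < 1) :
    Summable fun m : ℤ ↦ ‖(if m % 2 = 0 then 1 else -1) * x ^ pentagonal m‖ := by
  have h := (summable_geometric_of_lt_one (norm_nonneg x) hx).comp_injective pentagonal_injective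
  refine h.congr fun m ↦ ?_
  split_ifs <;> simp

theorem tprod_one_sub_pow_eq_tsum_pentagonal {x : ℂ} (hx : ‖x‖ < 1) :
    ∏' n : ℕ, (1 - x ^ (n + 1)) =
      ∑' m : ℤ, (if m % 2 = 0 then 1 else -1) * x ^ pentagonal m := by
  have hbound (k n : ℕ) : ‖x ^ ((k + 1) * n) * ∏ i ∈ Finset.range (n + 1), (1 - x ^ (k + i + 1))‖ ≤
      ‖x‖ ^ n * Real.exp (1 - ‖x‖)⁻¹ := by
    rw [norm_mul, norm_pow]
    gcongr ?_ * ?_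
    · exact pow_le_pow_of_le_one (norm_nonneg x) hx.le (by nlinarith)
    · exact norm_prod_one_sub_pow_le hx k (n + 1)
  have hgeom : Summable fun n : ℕ ↦ ‖x‖ ^ n * Real.exp (1 - ‖x‖)⁻¹ :=
    (summable_geometric_of_lt_one (norm_nonneg x) hx).mul_right _
  have hsum := (Equiv.neg ℤ).hasSum_iff.mpr (summable_norm_pow_pentagonal hx).of_norm.hasSum
  have hnat : HasSum (fun k : ℕ ↦ (-1) ^ k * (x ^ pentagonal (-k) - x ^ pentagonal (k + 1)))
      (∑' m : ℤ, (if m % 2 = 0 then 1 else -1) * x ^ pentagonal m) := by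
    refine hsum.nat_add_neg_add_one.congr_fun fun k ↦ ?_
    rcases Nat.even_or_odd k with hk | hk
    · have h₀ : (2 : ℤ) ∣ k := by grind
      have h₁ : ¬ (2 : ℤ) ∣ k + 1 := by grind
      simp [hk.neg_one_pow, h₀, h₁, sub_eq_add_neg]
    · have h₀ : ¬ (2 : ℤ) ∣ k := by grind
      have h₁ : (2 : ℤ) ∣ k + 1 := by grind
      simp [hk.neg_one_pow, h₀, h₁]
      ring
  rw [← hnat.tsum_eq]
  refine Pentagonal.tprod_one_sub_pow (tendsto_pow_atTop_nhds_zero_of_norm_lt_one hx)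
    (fun k ↦ .of_norm_bounded hgeom (hbound k)) (fun k ↦ ?_) hnat.summable ?_
  · refine multipliable_one_add_of_summable (f := fun n ↦ -x ^ (n + k + 1)) ?_
    simpa [add_assoc] using
      (summable_nat_add_iff (k + 1)).mpr (summable_geometric_of_lt_one (norm_nonneg x) hx)
  · refine squeeze_zero_norm (a := fun k ↦ ‖x‖ ^ k * ∑' n, ‖x‖ ^ n * Real.exp (1 - ‖x‖)⁻¹)
      (fun k ↦ ?_) ?_
    · rw [norm_mul, norm_mul, norm_pow, norm_neg, norm_one, one_pow, one_mul, norm_pow]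
      gcongr ?_ * ?_
      · refine pow_le_pow_of_le_one (norm_nonneg x) hx.le ?_
        rw [Nat.le_div_iff_mul_le two_pos]
        nlinarith
      · exact tsum_of_norm_bounded hgeom.hasSum (hbound k)
    · simpa using (tendsto_pow_atTop_nhds_zero_of_lt_one (norm_nonneg x) hx).mul_const _

theorem eta_eq_tsum_pentagonal {q : ℂ} (hq : ‖q‖ < 1) :
    (Summable fun v : ℤ × ℤ ↦ q ^ (1 + v.1 * (3 * v.1 - 1) + 11 * (v.2 * (3 * v.2 - 1)))) ∧
    q * ∏' n : ℕ, ((1 - q ^ (2 * (n + 1))) * (1 - q ^ (22 * (n + 1)))) =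
      ∑' v : ℤ × ℤ, (if (v.1 + v.2) % 2 = 0 then 1 else -1) *
        q ^ (1 + v.1 * (3 * v.1 - 1) + 11 * (v.2 * (3 * v.2 - 1))) := by
  have hpow (n : ℕ) (hn : n ≠ 0) : ‖q ^ n‖ < 1 := by
    rw [norm_pow]
    exact pow_lt_one₀ (norm_nonneg q) hq hn
  have h₂ := hpow 2 (by simp)
  have h₂₂ := hpow 22 (by simp)
  have hterm (v : ℤ × ℤ) : q * (((if v.1 % 2 = 0 then 1 else -1) * (q ^ 2) ^ pentagonal v.1) *
      ((if v.2 % 2 = 0 then 1 else -1) * (q ^ 22) ^ pentagonal v.2)) =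
      (if (v.1 + v.2) % 2 = 0 then 1 else -1) *
        q ^ (1 + v.1 * (3 * v.1 - 1) + 11 * (v.2 * (3 * v.2 - 1))) := by
    have hexp : 1 + v.1 * (3 * v.1 - 1) + 11 * (v.2 * (3 * v.2 - 1)) =
        ((1 + 2 * pentagonal v.1 + 22 * pentagonal v.2 : ℕ) : ℤ) := by
      push_cast
      linarith [two_mul_natCast_pentagonal v.1, two_mul_natCast_pentagonal v.2]
    have hsign : (if (v.1 + v.2) % 2 = 0 then 1 else -1 : ℂ) =
        (if v.1 % 2 = 0 then 1 else -1) * (if v.2 % 2 = 0 then 1 else -1) := by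
      split_ifs <;> first | omega | norm_num
    rw [hexp, zpow_natCast, hsign, pow_add, pow_add, pow_one, pow_mul, pow_mul]
    ring
  have hsum := ((summable_norm_pow_pentagonal h₂).mul_norm
    (summable_norm_pow_pentagonal h₂₂)).mul_left ‖q‖
  constructor
  · refine .of_norm (hsum.congr fun v ↦ ?_)
    rw [← norm_mul, hterm, norm_mul]
    split_ifs <;> simp
  · simp only [pow_mul]
    rw [(ModularForm.multipliable_one_sub_pow h₂).tprod_mul
      (ModularForm.multipliable_one_sub_pow h₂₂), tprod_one_sub_pow_eq_tsum_pentagonal h₂,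
      tprod_one_sub_pow_eq_tsum_pentagonal h₂₂, tsum_mul_tsum_of_summable_norm
      (summable_norm_pow_pentagonal h₂) (summable_norm_pow_pentagonal h₂₂), ← tsum_mul_left]
    exact tsum_congr hterm

theorem statement17 (q : ℂ) (hq : ‖q‖ < 1) :
    (∑' n : ℤ, (q) ^ (n ^ 2)) * (∑' n : ℤ, (q ^ 11) ^ (n ^ 2)) =
      1 + (2 / 3) * (∑' j : ℕ, (legendreSym 11 ((j : ℤ) + 1) : ℂ) * (q ^ (1 * (j + 1)) / (1 - q ^ (1 * (j + 1))) + 2 * q ^ (4 * (j + 1)) / (1 - q ^ (4 * (j + 1)))))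
        + (4 / 3) * (q * ∏' n : ℕ, ((1 - q ^ (2 * (n + 1))) * (1 - q ^ (22 * (n + 1))))) := by
  have hq₄ : ‖q ^ 4‖ < 1 := by
    rw [norm_pow]
    exact pow_lt_one₀ (norm_nonneg q) hq (by simp)
  obtain ⟨heta, hprod⟩ := eta_eq_tsum_pentagonal hq
  have hgenus := latticeSum_genus (g := fun k ↦ q ^ k)
    (summable_norm_zpow_of_sq_add_sq_le hq fun v ↦ by
      nlinarith [sq_nonneg (v.1 + v.2), sq_nonneg v.2, sq_nonneg v.1]).of_norm
  have hpent := two_mul_tsum_pentagonal (g := fun k ↦ q ^ k)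
    (summable_norm_zpow_of_sq_add_sq_le hq fun v ↦ by
      nlinarith [sq_nonneg v.2, sq_nonneg v.1]).of_norm
    (summable_norm_zpow_of_sq_add_sq_le hq fun v ↦ by
      nlinarith [sq_nonneg (v.1 + v.2), sq_nonneg v.2, sq_nonneg v.1]).of_norm heta
  have hfour : latticeSum 1 1 3 (fun k ↦ q ^ (4 * k)) = latticeSum 1 1 3 fun k ↦ (q ^ 4) ^ k := by
    simp only [zpow_mul]
    rfl
  have hlambert := (((hasSum_legendreSym_lambert hq).add
    ((hasSum_legendreSym_lambert hq₄).mul_left 2)).congr_fun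
      (g := fun j : ℕ ↦ (legendreSym 11 ((j : ℤ) + 1) : ℂ) *
        (q ^ (1 * (j + 1)) / (1 - q ^ (1 * (j + 1))) +
          2 * q ^ (4 * (j + 1)) / (1 - q ^ (4 * (j + 1))))) fun j ↦ by
        rw [one_mul, pow_mul q 4]
        ring).tsum_eq
  rw [tsum_zpow_sq_mul_tsum_zpow_sq hq, hlambert, hprod]
  rw [hfour] at hgenus
  linear_combination (1 / 3 : ℂ) * hgenus - (2 / 3 : ℂ) * hpent
end
end

section
/- For |q|<1, q³·ψ(q²)·ψ(q^{22}) = (1/3)·∑_{j≥1} χ₁₁(j)·( q^j/(1−q^j) − q^{4j}/(1−q^{4j}) ) − (1/3)·η₂η₂₂, where χ₁₁ is the Legendre symbol mod 11 and η₂η₂₂ = q·∏_{n≥1}(1−q^{2n})(1−q^{22n}). -/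
noncomputable section

namespace NormForm

/-- The integer pairs `(a, b)` with `a ^ 2 + 11 * b ^ 2 = 4 * N`; they correspond to the elements
`(a + b √-11) / 2` of norm `N` in the ring of integers of `ℚ(√-11)`. -/
def sol (N : ℕ) : Finset (ℤ × ℤ) :=
  (Finset.Icc (-(4 * N : ℤ)) (4 * N) ×ˢ Finset.Icc (-(4 * N : ℤ)) (4 * N)).filter
    fun x ↦ x.1 ^ 2 + 11 * x.2 ^ 2 = 4 * N

lemma mem_sol {N : ℕ} {x : ℤ × ℤ} : x ∈ sol N ↔ x.1 ^ 2 + 11 * x.2 ^ 2 = 4 * N := by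
  simp only [sol, Finset.mem_filter, Finset.mem_product, Finset.mem_Icc, and_iff_right_iff_imp]
  intro h
  refine ⟨⟨?_, ?_⟩, ?_, ?_⟩ <;> nlinarith [sq_nonneg x.1, sq_nonneg x.2, Int.le_self_sq x.1,
    Int.le_self_sq (-x.1), Int.le_self_sq x.2, Int.le_self_sq (-x.2)]

lemma even_sub_of_mem_sol {N : ℕ} {x : ℤ × ℤ} (hx : x ∈ sol N) : Even (x.1 - x.2) := by
  have h : Even (x.1 ^ 2 + 11 * x.2 ^ 2) := by
    rw [mem_sol.1 hx]; exact ⟨2 * N, by ring⟩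
  simp only [Int.even_add, Int.even_mul, Int.even_sub, Int.even_pow] at h ⊢
  have : ¬ Even (11 : ℤ) := by decide
  tauto

/-- Multiplication by `√-11` gives a bijection onto the elements whose norm is divisible by `11`. -/
lemma card_sol_eleven_mul (M : ℕ) : (sol (11 * M)).card = (sol M).card := by
  refine Finset.card_nbij' (fun x ↦ (x.2, x.1 / 11)) (fun x ↦ (11 * x.2, x.1)) ?_ ?_ ?_ ?_
  all_goals intro x hx
  all_goals simp only [Finset.mem_coe, mem_sol] at hx ⊢
  all_goals push_cast at hx ⊢
  · have h11 : (11 : ℤ) ∣ x.1 := by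
      refine Int.Prime.dvd_pow' (p := 11) (k := 2) (by norm_num) ?_
      exact ⟨4 * M - x.2 ^ 2, by push_cast; linarith⟩
    obtain ⟨k, hk⟩ := h11
    rw [hk, Int.mul_ediv_cancel_left _ (by norm_num)]
    rw [hk] at hx
    linarith
  · linarith
  · have h11 : (11 : ℤ) ∣ x.1 := by
      refine Int.Prime.dvd_pow' (p := 11) (k := 2) (by norm_num) ?_
      exact ⟨4 * M - x.2 ^ 2, by push_cast; linarith⟩
    ext <;> simp [Int.mul_ediv_cancel' h11]
  · ext <;> simp

lemma card_filter_dvd_sol {p : ℕ} (hp : p.Prime) (hp2 : p ≠ 2) (M : ℕ) :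
    ((sol (p * M)).filter fun x ↦ (p : ℤ) ∣ x.1 ∧ (p : ℤ) ∣ x.2).card =
      if p ∣ M then (sol (M / p)).card else 0 := by
  have hp0 : (p : ℤ) ≠ 0 := by exact_mod_cast hp.ne_zero
  split_ifs with h
  · obtain ⟨K, rfl⟩ := h
    rw [Nat.mul_div_cancel_left _ hp.pos]
    refine Finset.card_nbij' (fun x ↦ (x.1 / p, x.2 / p)) (fun x ↦ (p * x.1, p * x.2)) ?_ ?_ ?_ ?_
    all_goals rintro ⟨a, b⟩ hx
    all_goals simp only [Finset.coe_filter, Set.mem_ofPred_eq, Finset.mem_coe, mem_sol] at hx ⊢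
    all_goals push_cast at hx ⊢
    · obtain ⟨hx, ⟨a, rfl⟩, ⟨b, rfl⟩⟩ := hx
      rw [Int.mul_ediv_cancel_left _ hp0, Int.mul_ediv_cancel_left _ hp0]
      refine mul_left_cancel₀ (pow_ne_zero 2 hp0) ?_
      linarith
    · exact ⟨by linear_combination (p : ℤ) ^ 2 * hx, Dvd.intro _ rfl, Dvd.intro _ rfl⟩
    · simp [Int.mul_ediv_cancel' hx.2.1, Int.mul_ediv_cancel' hx.2.2]
    · simp [Int.mul_ediv_cancel_left _ hp0]
  · rw [Finset.card_eq_zero, Finset.filter_eq_empty_iff]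
    rintro ⟨a, b⟩ hx ⟨⟨a', ha⟩, ⟨b', hb⟩⟩
    rw [mem_sol] at hx
    simp only at ha hb hx
    apply h
    have h4 : p ∣ 4 * M := by
      rw [← Int.natCast_dvd_natCast]
      refine ⟨a' ^ 2 + 11 * b' ^ 2, mul_left_cancel₀ hp0 ?_⟩
      push_cast at hx ⊢
      rw [ha, hb] at hx
      linarith
    refine (Nat.Coprime.dvd_mul_left ?_).1 h4
    exact (Nat.coprime_pow_right_iff (n := 2) (by norm_num) p 2).2
      ((Nat.coprime_primes hp Nat.prime_two).2 hp2)

/-- If `π = (c + d √-11) / 2` has prime norm `p`, the elements of norm `p * M` that are divisible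
by `π` are counted by the elements of norm `M`. -/
lemma card_filter_dvd_sub_sol {p : ℕ} (hp : p.Prime) (hp2 : p ≠ 2) {c d : ℤ}
    (hcd : c ^ 2 + 11 * d ^ 2 = 4 * p) (M : ℕ) :
    ((sol (p * M)).filter fun x ↦ (p : ℤ) ∣ x.2 * c - x.1 * d).card = (sol M).card := by
  have hpr : Prime (p : ℤ) := Nat.prime_iff_prime_int.1 hp
  have hp0 : (p : ℤ) ≠ 0 := hpr.ne_zero
  have hcd2 : Even (c - d) := even_sub_of_mem_sol (x := (c, d)) (mem_sol.2 hcd)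
  have hcop : IsCoprime (2 : ℤ) (p : ℤ) := by
    rw [Int.isCoprime_iff_nat_coprime]
    exact (Nat.coprime_primes Nat.prime_two hp).2 (Ne.symm hp2)
  have key : ∀ a b : ℤ, (a, b) ∈ sol (p * M) → (p : ℤ) ∣ b * c - a * d →
      (2 * p : ℤ) ∣ a * c + 11 * b * d ∧ (2 * p : ℤ) ∣ b * c - a * d := by
    intro a b hx h
    have hab : Even (a - b) := even_sub_of_mem_sol hx
    rw [mem_sol] at hx
    push_cast at hx
    have h1 : (p : ℤ) ∣ a * c + 11 * b * d := by
      refine hpr.dvd_of_dvd_pow (n := 2) ?_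
      obtain ⟨k, hk⟩ := h
      refine ⟨16 * p * M - 11 * p * k ^ 2, ?_⟩
      linear_combination (4 * (p : ℤ)) * hx + (a ^ 2 + 11 * b ^ 2) * hcd
        - 11 * (b * c - a * d + p * k) * hk
    obtain ⟨i, hi⟩ := hab
    obtain ⟨j, hj⟩ := hcd2
    obtain rfl : a = b + (i + i) := by linarith
    obtain rfl : c = d + (j + j) := by linarith
    exact ⟨hcop.mul_dvd ⟨b * j + i * d + 2 * i * j + 6 * b * d, by ring⟩ h1,
      hcop.mul_dvd ⟨b * j - i * d, by ring⟩ h⟩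
  have key' : ∀ a b : ℤ, (a, b) ∈ sol M →
      (2 : ℤ) ∣ a * c - 11 * b * d ∧ (2 : ℤ) ∣ a * d + b * c := by
    intro a b hx
    obtain ⟨i, hi⟩ := even_sub_of_mem_sol hx
    obtain ⟨j, hj⟩ := hcd2
    obtain rfl : a = b + (i + i) := by linarith
    obtain rfl : c = d + (j + j) := by linarith
    exact ⟨⟨b * j + i * d + 2 * i * j - 5 * b * d, by ring⟩, ⟨b * d + i * d + b * j, by ring⟩⟩
  refine Finset.card_nbij'
    (fun x ↦ ((x.1 * c + 11 * x.2 * d) / (2 * p), (x.2 * c - x.1 * d) / (2 * p)))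
    (fun x ↦ ((x.1 * c - 11 * x.2 * d) / 2, (x.1 * d + x.2 * c) / 2)) ?_ ?_ ?_ ?_
  all_goals rintro ⟨a, b⟩ hx
  all_goals simp only [Finset.coe_filter, Set.mem_ofPred_eq, Finset.mem_coe] at hx ⊢
  · obtain ⟨⟨k, hk⟩, ⟨l, hl⟩⟩ := key a b hx.1 hx.2
    have hx := mem_sol.1 hx.1
    push_cast at hx
    rw [hk, hl, Int.mul_ediv_cancel_left _ (by positivity),
      Int.mul_ediv_cancel_left _ (by positivity), mem_sol]
    refine mul_left_cancel₀ (pow_ne_zero 2 (mul_ne_zero two_ne_zero hp0)) ?_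
    simp only at hx ⊢
    linear_combination (4 * (p : ℤ)) * hx + (a ^ 2 + 11 * b ^ 2) * hcd
        - 11 * (b * c - a * d + 2 * p * l) * hl - (a * c + 11 * b * d + 2 * p * k) * hk
  · obtain ⟨⟨k, hk⟩, ⟨l, hl⟩⟩ := key' a b hx
    rw [hk, hl, Int.mul_ediv_cancel_left _ two_ne_zero, Int.mul_ediv_cancel_left _ two_ne_zero]
    rw [mem_sol] at hx ⊢
    simp only at hx ⊢
    push_cast
    refine ⟨?_, 2 * b, ?_⟩
    · linarith [show 4 * (k ^ 2 + 11 * l ^ 2) = 4 * (4 * (p * M)) by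
        linear_combination (4 * (p : ℤ)) * hx + (a ^ 2 + 11 * b ^ 2) * hcd
          - 11 * (a * d + b * c + 2 * l) * hl - (a * c - 11 * b * d + 2 * k) * hk]
    · linarith [show 2 * (l * c - k * d) = 2 * (p * (2 * b)) by
        linear_combination b * hcd - c * hl + d * hk]
  · obtain ⟨⟨k, hk⟩, ⟨l, hl⟩⟩ := key a b hx.1 hx.2
    rw [hk, hl, Int.mul_ediv_cancel_left _ (by positivity),
      Int.mul_ediv_cancel_left _ (by positivity)]
    rw [show k * c - 11 * l * d = 2 * a from mul_left_cancel₀ (mul_ne_zero two_ne_zero hp0)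
        (by linear_combination a * hcd - c * hk + 11 * d * hl),
      show k * d + l * c = 2 * b from mul_left_cancel₀ (mul_ne_zero two_ne_zero hp0)
        (by linear_combination b * hcd - d * hk - c * hl)]
    simp
  · obtain ⟨⟨k, hk⟩, ⟨l, hl⟩⟩ := key' a b hx
    rw [hk, hl, Int.mul_ediv_cancel_left _ two_ne_zero, Int.mul_ediv_cancel_left _ two_ne_zero]
    rw [show k * c + 11 * l * d = 2 * p * a by
        linarith [show 2 * (k * c + 11 * l * d) = 2 * (2 * p * a) by
          linear_combination a * hcd - c * hk - 11 * d * hl],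
      show l * c - k * d = 2 * p * b by
        linarith [show 2 * (l * c - k * d) = 2 * (2 * p * b) by
          linear_combination b * hcd - c * hl + d * hk],
      Int.mul_ediv_cancel_left _ (by positivity), Int.mul_ediv_cancel_left _ (by positivity)]

/-- Every positive definite form `A x² + B x y + C y²` of discriminant `-11` arises from
`x² + x y + 3 y²` by a linear substitution. -/
lemma exists_eq_of_discrim_eq (A : ℕ) : ∀ B C : ℤ, B ^ 2 - 4 * A * C = -11 →
    ∃ p q r s : ℤ, A = p ^ 2 + p * q + 3 * q ^ 2 ∧ C = r ^ 2 + r * s + 3 * s ^ 2 ∧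
      B = 2 * p * r + p * s + q * r + 6 * q * s := by
  induction A using Nat.strong_induction_on with
  | _ A ih =>
  have reduced : ∀ B C : ℤ, B ^ 2 - 4 * A * C = -11 → -A ≤ B → B ≤ A →
      ∃ p q r s : ℤ, A = p ^ 2 + p * q + 3 * q ^ 2 ∧ C = r ^ 2 + r * s + 3 * s ^ 2 ∧
        B = 2 * p * r + p * s + q * r + 6 * q * s := by
    intro B C h h1 h2
    have hA : (0 : ℤ) ≤ A := by positivity
    have hC : 0 < C := by
      by_contra! hC
      nlinarith [mul_nonneg hA (neg_nonneg.2 hC)]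
    by_cases hCA : C < A
    · obtain ⟨p, q, r, s, e1, e2, e3⟩ := ih C.toNat (by omega) B A
        (by rw [Int.toNat_of_nonneg hC.le]; linarith)
      rw [Int.toNat_of_nonneg hC.le] at e1
      exact ⟨r, s, p, q, e2, e1, by linarith⟩
    · have hA1 : (A : ℤ) ≤ 1 := by
        by_contra! hA2
        nlinarith [mul_le_mul_of_nonneg_left (not_lt.1 hCA) hA]
      have hA0 : (A : ℤ) ≠ 0 := by
        intro h0
        rw [h0] at h
        nlinarith [sq_nonneg B]
      have hA' : (A : ℤ) = 1 := by omega
      rw [hA'] at h h1 h2 ⊢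
      have hB : B = -1 ∨ B = 0 ∨ B = 1 := by omega
      rcases hB with rfl | rfl | rfl
      · exact ⟨1, 0, -1, 1, by norm_num, by linarith, by norm_num⟩
      · omega
      · exact ⟨1, 0, 0, 1, by norm_num, by linarith, by norm_num⟩
  intro B C h
  have hA : (0 : ℤ) < A := by
    rcases Nat.eq_zero_or_pos A with rfl | hA
    · simp only [Nat.cast_zero] at h
      nlinarith [sq_nonneg B]
    · exact_mod_cast hA
  set t := (B + A) / (2 * A) with ht
  have hmod := Int.mul_ediv_add_emod (B + A) (2 * A)
  have hlt := Int.emod_lt_of_pos (B + A) (show (0 : ℤ) < 2 * A by linarith)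
  have hnn := Int.emod_nonneg (B + A) (show (2 * A : ℤ) ≠ 0 by linarith)
  rw [← ht] at hmod
  obtain ⟨p, q, r, s, e1, e2, e3⟩ := reduced (B - 2 * A * t) (A * t ^ 2 - B * t + C)
    (by linear_combination h) (by linarith) (by linarith)
  refine ⟨p, q, r + t * p, s + t * q, e1, ?_, ?_⟩
  · linear_combination e2 + t * e3 + t ^ 2 * e1
  · linear_combination e3 + 2 * t * e1

lemma legendreSym_neg_eleven {p : ℕ} [Fact p.Prime] (hp2 : p ≠ 2) :
    legendreSym p (-11) = legendreSym 11 p := by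
  rw [legendreSym.at_neg hp2, legendreSym.quadratic_reciprocity' hp2 (by norm_num),
    ZMod.χ₄_eq_neg_one_pow ((Nat.Prime.mod_two_eq_one_iff_ne_two Fact.out).2 hp2), pow_mul]
  norm_num
  left
  rcases neg_one_pow_eq_or ℤ (p / 2) with h | h <;> rw [h] <;> norm_num

lemma exists_eq_four_mul_prime {p : ℕ} [Fact p.Prime] (hp2 : p ≠ 2)
    (h : legendreSym 11 p = 1) : ∃ c d : ℤ, c ^ 2 + 11 * d ^ 2 = 4 * p := by
  have hp : p.Prime := Fact.out
  rw [← legendreSym_neg_eleven hp2] at h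
  have h0 : ((-11 : ℤ) : ZMod p) ≠ 0 := by
    intro h0
    rw [(legendreSym.eq_zero_iff p (-11)).2 h0] at h
    norm_num at h
  obtain ⟨z, hz⟩ := (legendreSym.eq_one_iff p h0).1 h
  obtain ⟨z, rfl⟩ := ZMod.intCast_surjective z
  have hdvd : (p : ℤ) ∣ z ^ 2 + 11 := by
    rw [← ZMod.intCast_zmod_eq_zero_iff_dvd]
    push_cast at hz ⊢
    linear_combination -hz
  have hodd : Odd (p : ℤ) := by exact_mod_cast hp.odd_of_ne_two hp2
  obtain ⟨w, hw, hwodd⟩ : ∃ w : ℤ, (p : ℤ) ∣ w ^ 2 + 11 ∧ Odd w := by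
    rcases Int.even_or_odd z with hz | hz
    · refine ⟨z + p, ?_, hz.add_odd hodd⟩
      rw [show (z + p) ^ 2 + 11 = z ^ 2 + 11 + p * (2 * z + p) by ring]
      exact hdvd.add (Dvd.intro _ rfl)
    · exact ⟨z, hdvd, hz⟩
  have h4 : (4 : ℤ) ∣ w ^ 2 + 11 := by
    obtain ⟨k, rfl⟩ := hwodd
    exact ⟨k ^ 2 + k + 3, by ring⟩
  have hcop : IsCoprime (4 : ℤ) p := by
    rw [Int.isCoprime_iff_nat_coprime]
    exact (Nat.coprime_pow_left_iff (n := 2) (by norm_num) 2 p).2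
      ((Nat.coprime_primes Nat.prime_two hp).2 hp2.symm)
  obtain ⟨C, hC⟩ := hcop.mul_dvd h4 hw
  obtain ⟨r, s, -, -, e, -, -⟩ := exists_eq_of_discrim_eq p w C (by linear_combination hC)
  exact ⟨2 * r + s, s, by rw [e]; ring⟩

/-- The number of elements of norm `p * M`, for an odd prime `p`. -/
lemma card_sol_prime_mul {p : ℕ} [Fact p.Prime] (hp2 : p ≠ 2) (M : ℕ) :
    ((sol (p * M)).card : ℤ) = (1 + legendreSym 11 p) * (sol M).card -
      legendreSym 11 p * (if p ∣ M then (sol (M / p)).card else 0 : ℕ) := by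
  have hp : p.Prime := Fact.out
  have hpr : Prime (p : ℤ) := Nat.prime_iff_prime_int.1 hp
  by_cases h0 : ((p : ℤ) : ZMod 11) = 0
  · have h11 : p = 11 := by
      rw [ZMod.intCast_zmod_eq_zero_iff_dvd, Int.natCast_dvd_natCast] at h0
      exact ((Nat.prime_dvd_prime_iff_eq (by norm_num) hp).1 h0).symm
    rw [(legendreSym.eq_zero_iff 11 p).2 h0, h11, card_sol_eleven_mul]
    ring
  rw [← card_filter_dvd_sol hp hp2]
  rcases legendreSym.eq_one_or_neg_one 11 h0 with h | h
  · rw [h]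
    obtain ⟨c, d, hcd⟩ := exists_eq_four_mul_prime hp2 h
    have h1 := card_filter_dvd_sub_sol hp hp2 hcd M
    have h2 := card_filter_dvd_sub_sol hp hp2 (c := c) (d := -d) (by rw [← hcd]; ring) M
    have hp2' : ¬ (p : ℤ) ∣ 2 := by
      exact_mod_cast (Nat.prime_dvd_prime_iff_eq hp Nat.prime_two).not.2 hp2
    have hp11 : ¬ (p : ℤ) ∣ 11 := by
      have h11 : Nat.Prime 11 := by norm_num
      intro hdvd
      obtain rfl := (Nat.prime_dvd_prime_iff_eq hp h11).1 (by exact_mod_cast hdvd)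
      exact h0 (by decide)
    have hd : ¬ (p : ℤ) ∣ d := by
      rintro ⟨d', rfl⟩
      obtain ⟨c', rfl⟩ : (p : ℤ) ∣ c :=
        hpr.dvd_of_dvd_pow (n := 2) ⟨4 - 11 * p * d' ^ 2, by linear_combination hcd⟩
      refine hp2' (hpr.dvd_of_dvd_pow (n := 2) ⟨c' ^ 2 + 11 * d' ^ 2, ?_⟩)
      refine mul_left_cancel₀ hpr.ne_zero ?_
      linear_combination -hcd
    have hunion := Finset.card_union_add_card_inter
      ((sol (p * M)).filter fun x ↦ (p : ℤ) ∣ x.2 * c - x.1 * d)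
      ((sol (p * M)).filter fun x ↦ (p : ℤ) ∣ x.2 * c - x.1 * -d)
    rw [← Finset.filter_or, ← Finset.filter_and, h1, h2] at hunion
    rw [Finset.filter_true_of_mem, Finset.filter_congr
      (q := fun x ↦ (p : ℤ) ∣ x.1 ∧ (p : ℤ) ∣ x.2)] at hunion
    · zify at hunion ⊢
      linarith
    · rintro ⟨a, b⟩ hx
      rw [mem_sol] at hx
      push_cast at hx
      simp only at hx ⊢
      constructor
      · rintro ⟨h3, h4⟩
        have h5 : (p : ℤ) ∣ 2 * a * d := by
          have := dvd_sub h4 h3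
          ring_nf at this ⊢
          exact this
        have ha : (p : ℤ) ∣ a :=
          (hpr.dvd_or_dvd ((hpr.dvd_or_dvd h5).resolve_right hd)).resolve_left hp2'
        refine ⟨ha, hpr.dvd_of_dvd_pow (n := 2) ((hpr.dvd_or_dvd ?_).resolve_left hp11)⟩
        obtain ⟨k, rfl⟩ := ha
        exact ⟨4 * M - p * k ^ 2, by linear_combination hx⟩
      · rintro ⟨ha, hb⟩
        exact ⟨dvd_sub (hb.mul_right _) (ha.mul_right _), dvd_sub (hb.mul_right _) (ha.mul_right _)⟩
    · rintro ⟨a, b⟩ hx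
      rw [mem_sol] at hx
      push_cast at hx
      refine hpr.dvd_or_dvd ⟨4 * (b ^ 2 - M * d ^ 2), ?_⟩
      linear_combination b ^ 2 * hcd - d ^ 2 * hx
  · rw [h, Finset.filter_true_of_mem]
    · ring
    · intro x hx
      refine legendreSym.prime_dvd_of_eq_neg_one (a := -11)
        ((legendreSym_neg_eleven hp2).trans h) ?_
      rw [mem_sol] at hx
      exact ⟨4 * M, by push_cast at hx; linarith⟩

/-- The sum of the Legendre symbols modulo `11` of the divisors of `N`. -/
def charSum (N : ℕ) : ℤ := ∑ d ∈ N.divisors, legendreSym 11 d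

lemma charSum_prime_mul {p : ℕ} (hp : p.Prime) {M : ℕ} (hM : M ≠ 0) :
    charSum (p * M) = (1 + legendreSym 11 p) * charSum M -
      legendreSym 11 p * (if p ∣ M then charSum (M / p) else 0) := by
  have hinj : Function.Injective (p * ·) := mul_right_injective₀ hp.ne_zero
  have himage : ∀ K : ℕ, ∑ d ∈ K.divisors.image (p * ·), legendreSym 11 d =
      legendreSym 11 p * charSum K := by
    intro K
    rw [Finset.sum_image hinj.injOn, charSum, Finset.mul_sum]
    simp [legendreSym.mul]
  have hunion : (p * M).divisors = M.divisors ∪ M.divisors.image (p * ·) := by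
    rw [Nat.divisors_mul, hp.divisors]
    ext d
    simp [Finset.mem_mul, hM]
  have hinter : M.divisors ∩ M.divisors.image (p * ·) =
      if p ∣ M then (M / p).divisors.image (p * ·) else ∅ := by
    split_ifs with h
    · obtain ⟨K, rfl⟩ := h
      rw [Nat.mul_div_cancel_left _ hp.pos]
      have hK : K ≠ 0 := right_ne_zero_of_mul hM
      ext d
      simp only [Finset.mem_inter, Finset.mem_image, Nat.mem_divisors]
      constructor
      · rintro ⟨⟨h1, -⟩, e, -, rfl⟩
        exact ⟨e, ⟨(Nat.mul_dvd_mul_iff_left hp.pos).1 h1, hK⟩, rfl⟩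
      · rintro ⟨e, ⟨h1, -⟩, rfl⟩
        exact ⟨⟨Nat.mul_dvd_mul_left p h1, hM⟩, e, ⟨h1.mul_left p, hM⟩, rfl⟩
    · rw [Finset.eq_empty_iff_forall_notMem]
      intro d
      simp only [Finset.mem_inter, Finset.mem_image, Nat.mem_divisors]
      rintro ⟨⟨h1, -⟩, e, -, rfl⟩
      exact h ((Dvd.intro _ rfl).trans h1)
  have h := Finset.sum_union_inter (s₁ := M.divisors) (s₂ := M.divisors.image (p * ·))
    (f := fun d : ℕ ↦ legendreSym 11 d)
  rw [← hunion, hinter, himage M] at h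
  have hif : ∑ d ∈ (if p ∣ M then (M / p).divisors.image (p * ·) else ∅), legendreSym 11 d =
      legendreSym 11 p * (if p ∣ M then charSum (M / p) else 0) := by
    split_ifs
    · exact himage _
    · simp
  rw [hif] at h
  simp only [charSum] at h ⊢
  linarith

lemma legendreSym_eleven_two : legendreSym 11 2 = -1 := by
  rw [legendreSym.eq_neg_one_iff]
  decide

lemma charSum_of_even {N : ℕ} (hN : Even N) (hN0 : N ≠ 0) :
    charSum N = if 4 ∣ N then charSum (N / 4) else 0 := by
  obtain ⟨M, rfl⟩ := even_iff_two_dvd.1 hN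
  rw [charSum_prime_mul Nat.prime_two (by omega), Nat.cast_two, legendreSym_eleven_two]
  have h1 : 4 ∣ 2 * M ↔ 2 ∣ M := by omega
  have h2 : 2 * M / 4 = M / 2 := by omega
  simp only [h1, h2]
  split_ifs <;> ring

lemma card_sol_one : (sol 1).card = 2 := by decide

theorem card_sol_eq {N : ℕ} (hN : Odd N) : ((sol N).card : ℤ) = 2 * charSum N := by
  induction N using Nat.strong_induction_on with
  | _ N ih =>
  rcases eq_or_ne N 1 with rfl | hN1
  · rw [card_sol_one]
    simp [charSum]
  obtain ⟨p, hp, M, rfl⟩ := Nat.exists_prime_and_dvd hN1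
  have : Fact p.Prime := ⟨hp⟩
  obtain ⟨hpodd, hModd⟩ := Nat.odd_mul.1 hN
  have hp2 : p ≠ 2 := by rintro rfl; exact absurd hpodd (by decide)
  have hlt : M < p * M := lt_mul_of_one_lt_left hModd.pos hp.one_lt
  rw [card_sol_prime_mul hp2, charSum_prime_mul hp hModd.pos.ne', ih M hlt hModd]
  split_ifs with h
  · obtain ⟨K, rfl⟩ := h
    rw [Nat.mul_div_cancel_left _ hp.pos]
    have hKodd := (Nat.odd_mul.1 hModd).2
    rw [ih K ((lt_mul_of_one_lt_left hKodd.pos hp.one_lt).trans hlt) hKodd]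
    ring
  · simp only [Nat.cast_zero]
    ring

/-- The indicator of the pairs of odd positive integers. -/
def oddWeight (x : ℤ × ℤ) : ℤ := if (Odd x.1 ∧ 0 < x.1) ∧ (Odd x.2 ∧ 0 < x.2) then 1 else 0

/-- The sign `(-1) ^ b` on the pairs `(a, b)` with `a + b ≡ r` modulo `12`. -/
def signWeight (r : ℤ) (x : ℤ × ℤ) : ℤ :=
  if (12 : ℤ) ∣ x.1 + x.2 - r then (if Even x.2 then 1 else -1) else 0

lemma sum_signWeight_six (N : ℕ) : ∑ x ∈ sol N, signWeight 6 x = 0 := by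
  simp only [signWeight]
  rw [← Finset.sum_filter]
  have key : ∀ x ∈ (sol N).filter (fun x ↦ (12 : ℤ) ∣ x.1 + x.2 - 6),
      ∃ u b : ℤ, Odd u ∧ x = (6 * u - b, b) ∧
        ((-(5 * x.1 + 11 * x.2) / 6, (5 * x.2 - x.1) / 6) : ℤ × ℤ) = (-5 * u - b, b - u) := by
    rintro ⟨a, b⟩ hx
    obtain ⟨k, hk⟩ := (Finset.mem_filter.1 hx).2
    simp only [Prod.mk.injEq] at hk ⊢
    exact ⟨2 * k + 1, b, ⟨k, rfl⟩, ⟨by linarith, rfl⟩, by omega, by omega⟩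
  refine Finset.sum_involution
    (fun x _ ↦ (-(5 * x.1 + 11 * x.2) / 6, (5 * x.2 - x.1) / 6)) ?_ ?_ ?_ ?_
  · intro x hx
    obtain ⟨u, b, hu, rfl, h⟩ := key x hx
    rw [h]
    have : Even (b - u) ↔ ¬ Even b := by
      rw [Int.even_sub, ← Int.not_odd_iff_even (n := u)]
      tauto
    simp only [this]
    split_ifs <;> simp
  · intro x hx _
    obtain ⟨u, b, ⟨k, rfl⟩, rfl, h⟩ := key x hx
    rw [h]
    simp only [ne_eq, Prod.mk.injEq]
    omega
  · intro x hx
    obtain ⟨u, b, ⟨k, rfl⟩, rfl, h⟩ := key x hx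
    rw [h]
    simp only [Finset.mem_filter, mem_sol] at hx ⊢
    exact ⟨by linear_combination hx.1, by omega⟩
  · intro x hx
    obtain ⟨u, b, -, rfl, h⟩ := key x hx
    simp only [Prod.mk.injEq]
    omega

lemma sum_sol_neg_left (N : ℕ) (f : ℤ × ℤ → ℤ) :
    ∑ x ∈ sol N, f (-x.1, x.2) = ∑ x ∈ sol N, f x := by
  refine Finset.sum_nbij' (fun x ↦ (-x.1, x.2)) (fun x ↦ (-x.1, x.2)) ?_ ?_ ?_ ?_ ?_ <;>
    simp [mem_sol]

lemma sum_sol_neg_right (N : ℕ) (f : ℤ × ℤ → ℤ) :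
    ∑ x ∈ sol N, f (x.1, -x.2) = ∑ x ∈ sol N, f x := by
  refine Finset.sum_nbij' (fun x ↦ (x.1, -x.2)) (fun x ↦ (x.1, -x.2)) ?_ ?_ ?_ ?_ ?_ <;>
    simp [mem_sol]

lemma sum_weight_signs {N : ℕ} (hN : Odd N) {a b : ℤ} (hx : (a, b) ∈ sol N)
    (f : ℤ × ℤ → ℤ)
    (hf : ∀ x, f x = 6 * oddWeight x + 2 * signWeight (-2) x + signWeight 6 x) :
    f (a, b) + f (-a, b) + f (a, -b) + f (-a, -b) = 4 := by
  have hpair : ∀ s : ℤ, Even s →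
      (2 * (if (12 : ℤ) ∣ s - -2 then 1 else 0) + (if (12 : ℤ) ∣ s - 6 then 1 else 0) +
      (2 * (if (12 : ℤ) ∣ -s - -2 then 1 else 0) + (if (12 : ℤ) ∣ -s - 6 then 1 else 0)) : ℤ) =
      2 * if s % 4 = 2 then 1 else 0 := by
    rintro s ⟨t, rfl⟩
    split_ifs <;> omega
  have hsub := even_sub_of_mem_sol hx
  have hadd : Even (a + b) := by simpa [Int.even_add, Int.even_sub] using hsub
  have h1 := hpair _ hadd
  have h2 := hpair _ hsub
  rw [show -(a + b) = -a + -b by ring] at h1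
  rw [show -(a - b) = -a + b by ring, sub_eq_add_neg a b] at h2
  rw [mem_sol] at hx
  simp only at hx
  simp only [hf, oddWeight, signWeight, even_neg, odd_neg, Int.neg_pos]
  rcases Int.even_or_odd b with hb | hb
  · have ha : Even a := by simpa [hb] using (Int.even_sub.1 hsub)
    have ho : ¬ Odd b := Int.not_odd_iff_even.2 hb
    obtain ⟨n, rfl⟩ := hN
    obtain ⟨i, rfl⟩ := ha
    obtain ⟨j, rfl⟩ := id hb
    have hij : Odd (i + j) := by
      have : Odd (i ^ 2 + 11 * j ^ 2) := ⟨n, by push_cast at hx; linarith⟩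
      have h11 : ¬ Even (11 : ℤ) := by decide
      simp only [← Int.not_even_iff_odd, Int.even_add, Int.even_mul, Int.even_pow] at this ⊢
      tauto
    obtain ⟨k, hk⟩ := hij
    rw [if_pos (c := (i + i + (j + j)) % 4 = 2) (by omega)] at h1
    rw [if_pos (c := (i + i + -(j + j)) % 4 = 2) (by omega)] at h2
    simp only [ho, hb, if_true, false_and, and_false, if_false]
    linarith
  · have ha : Odd a := by
      rw [← Int.not_even_iff_odd] at hb ⊢
      simpa [hb] using (Int.even_sub.1 hsub)
    have he : ¬ Even b := Int.not_even_iff_odd.2 hb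
    have hodd : (6 * (if 0 < a ∧ 0 < b then 1 else 0) + 6 * (if a < 0 ∧ 0 < b then 1 else 0) +
        6 * (if 0 < a ∧ b < 0 then 1 else 0) + 6 * (if a < 0 ∧ b < 0 then 1 else 0) : ℤ) = 6 := by
      obtain ⟨i, rfl⟩ := ha
      obtain ⟨j, rfl⟩ := hb
      split_ifs <;> omega
    have hmod : ((if (a + b) % 4 = 2 then 1 else 0) + (if (a + -b) % 4 = 2 then 1 else 0) : ℤ) =
        1 := by
      obtain ⟨i, rfl⟩ := ha
      obtain ⟨j, rfl⟩ := hb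
      split_ifs <;> omega
    have hneg : ∀ (P : Prop) [Decidable P], (if P then -1 else 0 : ℤ) = -(if P then 1 else 0) := by
      intro P _
      split_ifs <;> rfl
    simp only [ha, hb, he, true_and, if_false, hneg]
    linarith

lemma sum_weight_of_even {N : ℕ} (hN : Even N) :
    ∑ x ∈ sol N, oddWeight x = 0 ∧ ∑ x ∈ sol N, signWeight (-2) x = 0 := by
  have key : ∀ x ∈ sol N, ¬ Odd x.2 ∧ (4 : ℤ) ∣ x.1 + x.2 := by
    rintro ⟨a, b⟩ hx
    obtain ⟨k, hk⟩ := even_sub_of_mem_sol hx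
    obtain ⟨n, rfl⟩ := hN
    rw [mem_sol] at hx
    push_cast at hx
    simp only at hx hk ⊢
    obtain rfl : a = b + 2 * k := by linarith
    have hbk : 3 * b ^ 2 + b * k + k ^ 2 = 2 * n := by linarith
    have h3 : ¬ Even (3 : ℤ) := by decide
    have heven : Even (3 * b ^ 2 + b * k + k ^ 2) := hbk ▸ even_two_mul (n : ℤ)
    simp only [Int.even_add, Int.even_mul, Int.even_pow] at heven
    have hb : Even b := by tauto
    have hk' : Even k := by tauto
    refine ⟨Int.not_odd_iff_even.2 hb, ?_⟩
    obtain ⟨i, rfl⟩ := hb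
    obtain ⟨j, rfl⟩ := hk'
    exact ⟨i + j, by ring⟩
  constructor
  · refine Finset.sum_eq_zero fun x hx ↦ if_neg ?_
    exact fun h ↦ (key x hx).1 h.2.1
  · refine Finset.sum_eq_zero fun x hx ↦ if_neg ?_
    have := (key x hx).2
    omega

theorem three_mul_sum_oddWeight (N : ℕ) :
    3 * ∑ x ∈ sol N, oddWeight x =
      charSum N - (if 4 ∣ N then charSum (N / 4) else 0) - ∑ x ∈ sol N, signWeight (-2) x := by
  rcases Nat.even_or_odd N with hN | hN
  · rw [(sum_weight_of_even hN).1, (sum_weight_of_even hN).2]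
    rcases eq_or_ne N 0 with rfl | hN0
    · simp
    · rw [charSum_of_even hN hN0]
      ring
  · rw [if_neg (by rintro ⟨k, rfl⟩; exact Nat.not_odd_iff_even.2 ⟨2 * k, by ring⟩ hN)]
    set f : ℤ × ℤ → ℤ := fun x ↦ 6 * oddWeight x + 2 * signWeight (-2) x + signWeight 6 x with hf
    have h4 : ∑ x ∈ sol N, (f x + f (-x.1, x.2) + f (x.1, -x.2) + f (-x.1, -x.2)) =
        ∑ x ∈ sol N, 4 :=
      Finset.sum_congr rfl fun x hx ↦ sum_weight_signs hN hx f fun _ ↦ rfl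
    rw [Finset.sum_add_distrib, Finset.sum_add_distrib, Finset.sum_add_distrib,
      sum_sol_neg_left N f, sum_sol_neg_right N f, sum_sol_neg_left N (fun x ↦ f (x.1, -x.2)),
      sum_sol_neg_right N f, Finset.sum_const, nsmul_eq_mul, card_sol_eq hN] at h4
    have hsum : ∑ x ∈ sol N, f x = 6 * ∑ x ∈ sol N, oddWeight x +
        2 * ∑ x ∈ sol N, signWeight (-2) x + ∑ x ∈ sol N, signWeight 6 x := by
      simp only [hf, Finset.sum_add_distrib, Finset.mul_sum]
    rw [hsum, sum_signWeight_six] at h4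
    linarith

end NormForm

/-- Collects the terms of a series of monomials by exponent, when the index set embeds into a type
with finite sets `T N` containing the indices with exponent `N`. -/
lemma HasSum.collect_exponents {ι β : Type*} {e : ι → ℕ} {g : ι → β} (hg : Function.Injective g)
    {T : ℕ → Finset β} {w : β → ℤ} (hT : ∀ i, g i ∈ T (e i))
    (hrange : ∀ N, ∀ x ∈ T N, w x ≠ 0 → ∃ i, g i = x ∧ e i = N) {q S : ℂ}
    (h : HasSum (fun i ↦ (w (g i) : ℂ) * q ^ e i) S) :
    HasSum (fun N ↦ ((∑ x ∈ T N, w x : ℤ) : ℂ) * q ^ N) S := by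
  let φ : ι → Σ N, T N := fun i ↦ ⟨e i, g i, hT i⟩
  have hφ : Function.Injective φ := by
    intro i j hij
    apply hg
    exact congrArg (fun y : Σ N, T N ↦ (y.2 : β)) hij
  let F : (Σ N, T N) → ℂ := fun y ↦ (w y.2 : ℂ) * q ^ y.1
  have hF : HasSum F S := by
    refine (hφ.hasSum_iff ?_).1 h
    rintro ⟨N, x, hx⟩ hy
    by_contra hne
    obtain ⟨i, rfl, rfl⟩ := hrange N x hx fun h0 ↦ hne (by simp [F, h0])
    exact hy ⟨i, rfl⟩
  refine hF.sigma fun N ↦ ?_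
  convert hasSum_fintype (fun x : T N ↦ F ⟨N, x⟩) using 1
  push_cast
  rw [Finset.sum_mul, ← Finset.sum_attach]
  rfl

lemma HasSum.mul_of_summable_norm {ι κ R : Type*} [NormedCommRing R] [CompleteSpace R]
    {f : ι → R} {g : κ → R} {a b : R} (hf : HasSum f a) (hg : HasSum g b)
    (hf' : Summable fun i ↦ ‖f i‖) (hg' : Summable fun k ↦ ‖g k‖) :
    HasSum (fun i : ι × κ ↦ f i.1 * g i.2) (a * b) :=
  hf.mul hg (summable_mul_of_summable_norm hf' hg')

namespace Pentagonal

open Filter Topology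

variable {x : ℂ}

lemma summable_norm_pow (hx : ‖x‖ < 1) : Summable fun k : ℤ ↦ ‖x ^ pentagonal k‖ := by
  simp_rw [norm_pow]
  exact (summable_geometric_of_lt_one (norm_nonneg x) hx).comp_injective pentagonal_injective

lemma norm_prod_one_sub_pow_le (hx : ‖x‖ < 1) (k n : ℕ) :
    ‖∏ i ∈ Finset.range n, (1 - x ^ (k + i + 1))‖ ≤ Real.exp (1 - ‖x‖)⁻¹ := by
  have h0 := norm_nonneg x
  rw [norm_prod]
  calc ∏ i ∈ Finset.range n, ‖1 - x ^ (k + i + 1)‖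
      ≤ ∏ i ∈ Finset.range n, Real.exp (‖x‖ ^ i) := by
        refine Finset.prod_le_prod (fun _ _ ↦ norm_nonneg _) fun i _ ↦ ?_
        calc ‖1 - x ^ (k + i + 1)‖ ≤ ‖(1 : ℂ)‖ + ‖x ^ (k + i + 1)‖ := norm_sub_le _ _
          _ ≤ ‖x‖ ^ i + 1 := by
            rw [norm_one, norm_pow, add_comm]
            gcongr ?_ + 1
            exact pow_le_pow_of_le_one h0 hx.le (by omega)
          _ ≤ Real.exp (‖x‖ ^ i) := Real.add_one_le_exp _
    _ = Real.exp (∑ i ∈ Finset.range n, ‖x‖ ^ i) := (Real.exp_sum _ _).symm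
    _ ≤ Real.exp (1 - ‖x‖)⁻¹ := by
        rw [Real.exp_le_exp, ← tsum_geometric_of_lt_one h0 hx]
        exact (summable_geometric_of_lt_one h0 hx).sum_le_tsum _ fun _ _ ↦ by positivity

lemma norm_pow_mul_prod_le (hx : ‖x‖ < 1) (k n : ℕ) :
    ‖x ^ ((k + 1) * n) * ∏ i ∈ Finset.range (n + 1), (1 - x ^ (k + i + 1))‖ ≤
      ‖x‖ ^ n * Real.exp (1 - ‖x‖)⁻¹ := by
  rw [norm_mul, norm_pow]
  exact mul_le_mul (pow_le_pow_of_le_one (norm_nonneg x) hx.le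
    (Nat.le_mul_of_pos_left n k.succ_pos)) (norm_prod_one_sub_pow_le hx k (n + 1))
    (norm_nonneg _) (by positivity)

lemma multipliable_one_sub_pow (hx : ‖x‖ < 1) (k : ℕ) :
    Multipliable fun n ↦ 1 - x ^ (n + k + 1) := by
  simp_rw [sub_eq_add_neg]
  refine multipliable_one_add_of_summable ?_
  simp_rw [norm_neg, norm_pow]
  exact (summable_geometric_of_lt_one (norm_nonneg x) hx).comp_injective
    (i := fun n ↦ n + k + 1) fun a b h ↦ by simpa using h

/-- **Pentagonal number theorem** for complex numbers in the open unit disc. -/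
theorem hasSum_pow (hx : ‖x‖ < 1) :
    HasSum (fun k : ℤ ↦ ((k.negOnePow : ℤ) : ℂ) * x ^ pentagonal k)
      (∏' n : ℕ, (1 - x ^ (n + 1))) := by
  have hbound : Summable fun n ↦ ‖x‖ ^ n * Real.exp (1 - ‖x‖)⁻¹ :=
    (summable_geometric_of_lt_one (norm_nonneg x) hx).mul_right _
  have hs : Summable fun k : ℤ ↦ ((k.negOnePow : ℤ) : ℂ) * x ^ pentagonal k := by
    refine Summable.of_norm_bounded (summable_norm_pow hx) fun k ↦ ?_
    rw [norm_mul]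
    rcases Int.even_or_odd k with hk | hk <;> simp [hk]
  have hneg : HasSum (fun k : ℤ ↦ (((-k).negOnePow : ℤ) : ℂ) * x ^ pentagonal (-k))
      (∑' k : ℤ, ((k.negOnePow : ℤ) : ℂ) * x ^ pentagonal k) :=
    (Equiv.neg ℤ).hasSum_iff.2 hs.hasSum
  have hnat := hneg.nat_add_neg_add_one
  have hterm : ∀ k : ℕ, (((-(k : ℤ)).negOnePow : ℤ) : ℂ) * x ^ pentagonal (-k) +
      (((-(-((k : ℤ) + 1))).negOnePow : ℤ) : ℂ) * x ^ pentagonal (-(-((k : ℤ) + 1))) =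
      (-1) ^ k * (x ^ pentagonal (-k) - x ^ pentagonal (k + 1)) := by
    intro k
    rw [neg_neg, Int.negOnePow_neg, Int.negOnePow_succ]
    simp [Int.negOnePow_def]
    ring
  simp_rw [hterm] at hnat
  rw [tprod_one_sub_pow (tendsto_pow_atTop_nhds_zero_of_norm_lt_one hx) ?_
    (multipliable_one_sub_pow hx) hnat.summable ?_, hnat.tsum_eq]
  · exact hs.hasSum
  · exact fun k ↦ Summable.of_norm_bounded hbound (norm_pow_mul_prod_le hx k)
  · rw [tendsto_zero_iff_norm_tendsto_zero]
    refine squeeze_zero (g := fun k ↦ ‖x‖ ^ k * ∑' n, ‖x‖ ^ n * Real.exp (1 - ‖x‖)⁻¹)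
      (fun _ ↦ norm_nonneg _) (fun k ↦ ?_) ?_
    · rw [norm_mul, norm_mul, norm_pow, norm_pow, norm_neg, norm_one, one_pow, one_mul]
      refine mul_le_mul (pow_le_pow_of_le_one (norm_nonneg x) hx.le ?_)
        (tsum_of_norm_bounded hbound.hasSum (norm_pow_mul_prod_le hx k)) (norm_nonneg _)
        (by positivity)
      rw [Nat.le_div_iff_mul_le two_pos]
      nlinarith
    · simpa using (tendsto_pow_atTop_nhds_zero_of_lt_one (norm_nonneg x) hx).mul_const
        (∑' n, ‖x‖ ^ n * Real.exp (1 - ‖x‖)⁻¹)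

end Pentagonal

namespace NormForm

variable {q : ℂ}

lemma norm_pow_lt_one (hq : ‖q‖ < 1) {c : ℕ} (hc : c ≠ 0) : ‖q ^ c‖ < 1 := by
  rw [norm_pow]
  exact pow_lt_one₀ (norm_nonneg q) hq hc

lemma hasSum_eta (hq : ‖q‖ < 1) :
    HasSum (fun N : ℕ ↦ ((∑ x ∈ sol N, signWeight (-2) x : ℤ) : ℂ) * q ^ N)
      (q * ∏' n : ℕ, ((1 - q ^ (2 * (n + 1))) * (1 - q ^ (22 * (n + 1))))) := by
  have h2 := norm_pow_lt_one hq two_ne_zero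
  have h22 := norm_pow_lt_one hq (c := 22) (by norm_num)
  have hprod : ∏' n : ℕ, ((1 - q ^ (2 * (n + 1))) * (1 - q ^ (22 * (n + 1)))) =
      (∏' n : ℕ, (1 - (q ^ 2) ^ (n + 1))) * ∏' n : ℕ, (1 - (q ^ 22) ^ (n + 1)) := by
    simp_rw [pow_mul]
    exact (Pentagonal.multipliable_one_sub_pow h2 0).tprod_mul
      (Pentagonal.multipliable_one_sub_pow h22 0)
  have hnorm : ∀ y : ℂ, ‖y‖ < 1 →
      Summable fun k : ℤ ↦ ‖((k.negOnePow : ℤ) : ℂ) * y ^ pentagonal k‖ := by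
    intro y hy
    refine (Pentagonal.summable_norm_pow hy).congr fun k ↦ ?_
    rw [norm_mul]
    rcases Int.even_or_odd k with hk | hk <;> simp [hk]
  have h := ((Pentagonal.hasSum_pow h2).mul_of_summable_norm (Pentagonal.hasSum_pow h22)
    (hnorm _ h2) (hnorm _ h22)).mul_left q
  rw [← hprod] at h
  have hcast : ∀ m n : ℤ, (m + 11 * n - 2) ^ 2 + 11 * (n - m) ^ 2 =
      4 * (1 + 2 * pentagonal m + 22 * pentagonal n : ℕ) := by
    intro m n
    push_cast
    linear_combination -4 * two_mul_natCast_pentagonal m - 44 * two_mul_natCast_pentagonal n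
  refine HasSum.collect_exponents (ι := ℤ × ℤ) (T := sol) (w := signWeight (-2))
    (e := fun i ↦ 1 + 2 * pentagonal i.1 + 22 * pentagonal i.2)
    (g := fun i ↦ (i.1 + 11 * i.2 - 2, i.2 - i.1)) ?_ ?_ ?_ ?_
  · rintro ⟨m, n⟩ ⟨m', n'⟩ h
    simp only [Prod.mk.injEq] at h ⊢
    omega
  · rintro ⟨m, n⟩
    exact mem_sol.2 (hcast m n)
  · rintro N ⟨a, b⟩ hx hw
    have hdvd : (12 : ℤ) ∣ a + b - -2 := by
      by_contra hdvd
      exact hw (if_neg hdvd)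
    obtain ⟨n, hn⟩ := hdvd
    obtain rfl : a = 12 * n - 2 - b := by linarith
    have hg : (((n - b) + 11 * n - 2, n - (n - b)) : ℤ × ℤ) = (12 * n - 2 - b, b) := by
      ext
      · simp; ring
      · simp
    refine ⟨(n - b, n), hg, ?_⟩
    have h1 := hcast (n - b) n
    rw [mem_sol, ← hg] at hx
    simp only at hx ⊢
    omega
  · refine h.congr_fun fun i ↦ ?_
    obtain ⟨m, n⟩ := i
    have hdvd : (12 : ℤ) ∣ m + 11 * n - 2 + (n - m) - -2 := ⟨n, by ring⟩
    have hsign : (if Even (n - m) then 1 else -1 : ℤ) = m.negOnePow * n.negOnePow := by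
      rw [mul_comm, ← Units.val_mul, ← Int.negOnePow_sub]
      split_ifs with heven
      · simp [Int.negOnePow_even _ heven]
      · simp [Int.negOnePow_odd _ (Int.not_even_iff_odd.1 heven)]
    rw [signWeight, if_pos hdvd, hsign]
    push_cast
    ring

lemma summable_norm_triangular (hq : ‖q‖ < 1) :
    Summable fun n : ℕ ↦ ‖q ^ (n * (n + 1) / 2)‖ := by
  simp_rw [norm_pow]
  refine (summable_geometric_of_lt_one (norm_nonneg q) hq).comp_injective
    (i := fun n ↦ n * (n + 1) / 2) (StrictMono.injective (strictMono_nat_of_lt_succ fun n ↦ ?_))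
  rw [show (n + 1) * (n + 1 + 1) = n * (n + 1) + (n + 1) * 2 by ring,
    Nat.add_mul_div_right _ _ two_pos]
  omega

lemma hasSum_triangular (hq : ‖q‖ < 1) :
    HasSum (fun n : ℕ ↦ q ^ (n * (n + 1) / 2)) (∑' n : ℕ, q ^ (n * (n + 1) / 2)) :=
  (summable_norm_triangular hq).of_norm.hasSum

lemma hasSum_psi (hq : ‖q‖ < 1) :
    HasSum (fun N : ℕ ↦ ((∑ x ∈ sol N, oddWeight x : ℤ) : ℂ) * q ^ N)
      (q ^ 3 * (∑' n : ℕ, (q ^ 2) ^ (n * (n + 1) / 2)) *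
        (∑' n : ℕ, (q ^ 22) ^ (n * (n + 1) / 2))) := by
  have hq2 := norm_pow_lt_one hq two_ne_zero
  have hq22 := norm_pow_lt_one hq (c := 22) (by norm_num)
  have h := ((hasSum_triangular hq2).mul_of_summable_norm (hasSum_triangular hq22)
    (summable_norm_triangular hq2) (summable_norm_triangular hq22)).mul_left (q ^ 3)
  rw [← mul_assoc] at h
  have htri : ∀ n : ℕ, 2 * (n * (n + 1) / 2) = n * (n + 1) := fun n ↦
    Nat.two_mul_div_two_of_even (Nat.even_mul_succ_self n)
  have hcast : ∀ m n : ℕ, (2 * m + 1 : ℤ) ^ 2 + 11 * (2 * n + 1 : ℤ) ^ 2 =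
      4 * (3 + 2 * (m * (m + 1) / 2) + 22 * (n * (n + 1) / 2) : ℕ) := by
    intro m n
    rw [show 22 * (n * (n + 1) / 2) = 11 * (2 * (n * (n + 1) / 2)) by ring, htri, htri]
    push_cast
    ring
  refine HasSum.collect_exponents (ι := ℕ × ℕ) (T := sol) (w := oddWeight)
    (e := fun i ↦ 3 + 2 * (i.1 * (i.1 + 1) / 2) + 22 * (i.2 * (i.2 + 1) / 2))
    (g := fun i ↦ ((2 * i.1 + 1 : ℤ), (2 * i.2 + 1 : ℤ))) ?_ ?_ ?_ ?_
  · rintro ⟨m, n⟩ ⟨m', n'⟩ h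
    simp only [Prod.mk.injEq] at h ⊢
    omega
  · rintro ⟨m, n⟩
    exact mem_sol.2 (hcast m n)
  · rintro N ⟨a, b⟩ hx hw
    have hab : (Odd a ∧ 0 < a) ∧ (Odd b ∧ 0 < b) := by
      by_contra hab
      exact hw (if_neg hab)
    obtain ⟨⟨⟨m, rfl⟩, hm⟩, ⟨n, rfl⟩, hn⟩ := hab
    lift m to ℕ using (by omega)
    lift n to ℕ using (by omega)
    refine ⟨(m, n), rfl, ?_⟩
    have h1 := hcast m n
    rw [mem_sol] at hx
    simp only at hx ⊢
    omega
  · refine h.congr_fun fun i ↦ ?_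
    obtain ⟨m, n⟩ := i
    rw [oddWeight, if_pos ⟨⟨⟨m, rfl⟩, by positivity⟩, ⟨n, rfl⟩, by positivity⟩]
    push_cast
    ring

/-- The Lambert series of the Legendre symbol modulo `11`, evaluated at `q ^ c`. -/
lemma hasSum_lambert (hq : ‖q‖ < 1) {c : ℕ} (hc : c ≠ 0) :
    HasSum (fun N : ℕ ↦ ((if c ∣ N then charSum (N / c) else 0 : ℤ) : ℂ) * q ^ N)
        (∑' j : ℕ, (legendreSym 11 ((j : ℤ) + 1) : ℂ) *
          (q ^ (c * (j + 1)) / (1 - q ^ (c * (j + 1))))) ∧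
      Summable fun j : ℕ ↦ (legendreSym 11 ((j : ℤ) + 1) : ℂ) *
        (q ^ (c * (j + 1)) / (1 - q ^ (c * (j + 1)))) := by
  have hle : ∀ a : ℤ, ‖(legendreSym 11 a : ℂ)‖ ≤ 1 := by
    intro a
    by_cases ha : (a : ZMod 11) = 0
    · simp [(legendreSym.eq_zero_iff 11 a).2 ha]
    · rcases legendreSym.eq_one_or_neg_one 11 ha with h | h <;> simp [h]
  have hsum : Summable fun i : ℕ × ℕ ↦
      (legendreSym 11 ((i.1 : ℤ) + 1) : ℂ) * q ^ (c * (i.1 + 1) * (i.2 + 1)) := by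
    have hgeom := summable_geometric_of_lt_one (norm_nonneg q) hq
    refine Summable.of_norm_bounded
      (hgeom.mul_of_nonneg hgeom (fun _ ↦ by positivity) (fun _ ↦ by positivity)) ?_
    rintro ⟨j, k⟩
    rw [norm_mul, norm_pow, ← pow_add]
    refine (mul_le_of_le_one_left (by positivity) (hle _)).trans
      (pow_le_pow_of_le_one (norm_nonneg q) hq.le ?_)
    have h1 : (j + 1) * (k + 1) ≤ c * ((j + 1) * (k + 1)) :=
      Nat.le_mul_of_pos_left _ (Nat.pos_of_ne_zero hc)
    simp only
    nlinarith
  have hrow : ∀ j : ℕ, HasSum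
      (fun k : ℕ ↦ (legendreSym 11 ((j : ℤ) + 1) : ℂ) * q ^ (c * (j + 1) * (k + 1)))
      ((legendreSym 11 ((j : ℤ) + 1) : ℂ) * (q ^ (c * (j + 1)) / (1 - q ^ (c * (j + 1))))) := by
    intro j
    have hj := hasSum_geometric_of_norm_lt_one
      (norm_pow_lt_one hq (mul_ne_zero hc j.succ_ne_zero))
    rw [div_eq_mul_inv]
    refine ((hj.mul_left (q ^ (c * (j + 1)))).mul_left _).congr_fun fun k ↦ ?_
    rw [pow_mul q (c * (j + 1)), pow_succ' _ k]
  have htotal := hsum.hasSum.prod_fiberwise hrow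
  refine ⟨?_, htotal.summable⟩
  rw [htotal.tsum_eq]
  have hcollect := HasSum.collect_exponents (ι := ℕ × ℕ) (β := ℕ × ℕ)
    (e := fun i ↦ c * (i.1 + 1) * (i.2 + 1)) (g := fun i ↦ (i.1 + 1, i.2 + 1))
    (T := fun N ↦ if c ∣ N then (N / c).divisorsAntidiagonal else ∅)
    (w := fun x ↦ legendreSym 11 x.1) (q := q)
    (S := ∑' i : ℕ × ℕ, (legendreSym 11 ((i.1 : ℤ) + 1) : ℂ) * q ^ (c * (i.1 + 1) * (i.2 + 1)))
    ?_ ?_ ?_ ?_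
  · convert hcollect using 5 with N
    split_ifs
    · exact (Nat.sum_divisorsAntidiagonal fun d _ ↦ legendreSym 11 d).symm
    · simp
  · rintro ⟨j, k⟩ ⟨j', k'⟩ h
    simpa using h
  · rintro ⟨j, k⟩
    have hdvd : c ∣ c * (j + 1) * (k + 1) := ⟨(j + 1) * (k + 1), by ring⟩
    simp only [if_pos hdvd, Nat.mem_divisorsAntidiagonal]
    rw [mul_assoc, Nat.mul_div_cancel_left _ (Nat.pos_of_ne_zero hc)]
    exact ⟨rfl, by positivity⟩
  · rintro N ⟨a, b⟩ hx -
    split_ifs at hx with h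
    · obtain ⟨K, rfl⟩ := h
      rw [Nat.mul_div_cancel_left _ (Nat.pos_of_ne_zero hc), Nat.mem_divisorsAntidiagonal] at hx
      obtain ⟨rfl, h0⟩ := hx
      simp only at h0
      obtain ⟨a, rfl⟩ := Nat.exists_eq_succ_of_ne_zero (left_ne_zero_of_mul h0)
      obtain ⟨b, rfl⟩ := Nat.exists_eq_succ_of_ne_zero (right_ne_zero_of_mul h0)
      exact ⟨(a, b), rfl, mul_assoc _ _ _⟩
    · simp at hx
  · convert hsum.hasSum using 2 with i
    simp

end NormForm

theorem statement18 (q : ℂ) (hq : ‖q‖ < 1) :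
    q ^ 3 * (∑' n : ℕ, (q ^ 2) ^ (n * (n + 1) / 2)) * (∑' n : ℕ, (q ^ 22) ^ (n * (n + 1) / 2)) =
      (1 / 3) * (∑' j : ℕ, (legendreSym 11 ((j : ℤ) + 1) : ℂ) * (q ^ (1 * (j + 1)) / (1 - q ^ (1 * (j + 1))) - q ^ (4 * (j + 1)) / (1 - q ^ (4 * (j + 1))))) - (1 / 3) * (q * ∏' n : ℕ, ((1 - q ^ (2 * (n + 1))) * (1 - q ^ (22 * (n + 1))))) := by
  obtain ⟨h1, hs1⟩ := NormForm.hasSum_lambert hq one_ne_zero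
  obtain ⟨h4, hs4⟩ := NormForm.hasSum_lambert hq four_ne_zero
  simp_rw [mul_sub (legendreSym 11 _ : ℂ)]
  rw [hs1.tsum_sub hs4, ← mul_sub]
  refine (NormForm.hasSum_psi hq).unique ?_
  refine (((h1.sub h4).sub (NormForm.hasSum_eta hq)).mul_left (1 / 3 : ℂ)).congr_fun fun N ↦ ?_
  have h : (3 : ℂ) * ((∑ x ∈ NormForm.sol N, NormForm.oddWeight x : ℤ) : ℂ) =
      (NormForm.charSum N : ℂ) -
        ((if 4 ∣ N then NormForm.charSum (N / 4) else 0 : ℤ) : ℂ) -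
        ((∑ x ∈ NormForm.sol N, NormForm.signWeight (-2) x : ℤ) : ℂ) := by
    exact_mod_cast NormForm.three_mul_sum_oddWeight N
  rw [if_pos (one_dvd N), Nat.div_one]
  linear_combination (1 / 3 : ℂ) * q ^ N * h
end
end
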